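/- The class of strongly mixing rank-one systems is a flexible class. -/

import Mathlib

/-- A measure-theoretic dynamical system: an invertible bimeasurable transformation
of a measure space. -/
structure MSystem where
  carrier : Type
  [meas : MeasurableSpace carrier]
  μ : MeasureTheory.Measure carrier
  T : carrier ≃ᵐ carrier

attribute [instance] MSystem.meas

open MeasureTheory Filter Set Topology

/-- A cutting and spacing parameter: an integer `q ≥ 2` (the cutting parameter) together
with nonnegative integers `σ 0, …, σ q` (the spacing parameters), represented as a
function `ℕ → ℕ` vanishing above `q`. -/
structure CSParam where
  q : ℕ
  two_le_q : 2 ≤ q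
  σ : ℕ → ℕ
  σ_eq_zero_of_gt : ∀ i, q < i → σ i = 0

/-- The total number `σ_n = σ_{n,0} + ⋯ + σ_{n,q_n}` of spacers added at one step. -/
def CSParam.σtot (P : CSParam) : ℕ := ∑ i ∈ Finset.range (P.q + 1), P.σ i

/-- The height sequence associated with a sequence of cutting and spacing parameters:
`h 0 = 1` and `h (n+1) = q_n · h_n + σ_n`. -/
def heights (p : ℕ → CSParam) : ℕ → ℕ
  | 0 => 1
  | n + 1 => (p n).q * heights p n + (p n).σtot

/-- `Z_n`, the maximum spacing parameter over the first `n+1` steps. -/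
def Zmax (p : ℕ → CSParam) (n : ℕ) : ℕ :=
  (Finset.range (n + 1)).sup fun j => (Finset.range ((p j).q + 1)).sup (p j).σ

/-- Condition (F): the series `Σ σ_n / h_{n+1}` converges. -/
def CondF (p : ℕ → CSParam) : Prop :=
  Summable fun n => ((p n).σtot : ℝ) / (heights p (n + 1) : ℝ)

/-- The level of the `(n+1)`-th tower at which the `i`-th subcolumn of the `n`-th
tower starts, namely `σ_{n,0} + ⋯ + σ_{n,i} + i·h_n`. -/
def colStart (p : ℕ → CSParam) (n i : ℕ) : ℕ :=
  (∑ j ∈ Finset.range (i + 1), (p n).σ j) + i * heights p n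

/-- The subset `X_n` covered by the `n`-th tower. -/
def towerUnion {X : Type} [MeasurableSpace X] (T : X ≃ᵐ X) (p : ℕ → CSParam)
    (B : ℕ → Set X) (n : ℕ) : Set X :=
  ⋃ k ∈ Finset.range (heights p n), (⇑T)^[k] '' B n

/-- A cutting-and-stacking tower structure for `T`, with parameters `p`, bases `B n`
(so that the `n`-th tower has levels `T^k (B n)`, `k < h_n`), and subdivision
`Bsub n 0, …, Bsub n (q_n - 1)` of `B n`: the `(n+1)`-th tower is obtained by stacking,
in order, `σ_{n,0}` spacer levels, the subcolumn over `Bsub n 0`, `σ_{n,1}` spacer levels,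
…, the subcolumn over `Bsub n (q_n-1)`, and `σ_{n,q_n}` spacer levels on top, the spacer
levels being disjoint from `X_n`. -/
structure IsCuttingStacking {X : Type} [MeasurableSpace X] (T : X ≃ᵐ X)
    (p : ℕ → CSParam) (B : ℕ → Set X) (Bsub : ℕ → ℕ → Set X) : Prop where
  meas_base : ∀ n, MeasurableSet (B n)
  meas_sub : ∀ n, ∀ i < (p n).q, MeasurableSet (Bsub n i)
  disj_levels : ∀ n, ∀ k < heights p n, ∀ l < heights p n, k ≠ l →
    Disjoint ((⇑T)^[k] '' B n) ((⇑T)^[l] '' B n)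
  disj_sub : ∀ n, ∀ i < (p n).q, ∀ j < (p n).q, i ≠ j → Disjoint (Bsub n i) (Bsub n j)
  union_sub : ∀ n, B n = ⋃ i ∈ Finset.range (p n).q, Bsub n i
  subcolumn : ∀ n, ∀ i < (p n).q, ∀ k < heights p n,
    (⇑T)^[colStart p n i + k] '' B (n + 1) = (⇑T)^[k] '' Bsub n i
  spacer_disjoint : ∀ n, ∀ l < heights p (n + 1),
    (∀ i < (p n).q, ∀ k < heights p n, l ≠ colStart p n i + k) →
    Disjoint ((⇑T)^[l] '' B (n + 1)) (towerUnion T p B n)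

/-- The towers with bases `B n` increase to the full σ-algebra modulo `μ`-null sets. -/
def TowersGenerate {X : Type} [MeasurableSpace X] (μ : Measure X) (T : X ≃ᵐ X)
    (p : ℕ → CSParam) (B : ℕ → Set X) : Prop :=
  ∀ A : Set X, MeasurableSet A → ∃ A' : Set X,
    MeasurableSet[MeasurableSpace.generateFrom
      {s : Set X | ∃ n k, k < heights p n ∧ s = (⇑T)^[k] '' B n}] A' ∧
    μ (symmDiff A A') = 0

/-- `T` is a rank-one system with cutting and spacing parameters `p` on `(X, μ)`. -/
def IsRankOneWith {X : Type} [MeasurableSpace X] (μ : Measure X) (T : X ≃ᵐ X)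
    (p : ℕ → CSParam) : Prop :=
  MeasurePreserving T μ μ ∧ CondF p ∧
    ∃ B Bsub, IsCuttingStacking T p B Bsub ∧ TowersGenerate μ T p B

/-- `T` is a rank-one system on `(X, μ)`. -/
def IsRankOne {X : Type} [MeasurableSpace X] (μ : Measure X) (T : X ≃ᵐ X) : Prop :=
  ∃ p, IsRankOneWith μ T p

/-- Iterates, indexed by `ℤ`, of a measurable equivalence. -/
def zIter {X : Type} [MeasurableSpace X] (T : X ≃ᵐ X) (n : ℤ) (x : X) : X :=
  if 0 ≤ n then (⇑T)^[n.toNat] x else (⇑T.symm)^[(-n).toNat] x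

/-- The `T`-orbit of a point. -/
def orbit {X : Type} [MeasurableSpace X] (T : X ≃ᵐ X) (x : X) : Set X :=
  Set.range fun n : ℤ => zIter T n x

/-- `S` is the universal odometer: a rank-one system admitting a construction with no
spacers whose cutting parameters `q'_n` are such that every positive integer divides
some product `q'_0 ⋯ q'_{n-1}`. -/
def IsUniversalOdometer {X : Type} [MeasurableSpace X] (μ : Measure X) (S : X ≃ᵐ X) : Prop :=
  ∃ p : ℕ → CSParam, IsRankOneWith μ S p ∧ (∀ n i, (p n).σ i = 0) ∧
    ∀ N : ℕ, 0 < N → ∃ n, N ∣ ∏ k ∈ Finset.range n, (p k).q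

/-- `T` (acting on `(X,μ)`) and `S` (acting on `(Y,ν)`) are φ-integrably orbit
equivalent: there is a measure-preserving bimeasurable bijection matching a.e. `T`-orbit
with the corresponding `S`-orbit, whose cocycles `c_T`, `c_S` satisfy
`∫ φ(|c_T|) dμ < ∞` and `∫ φ(|c_S|) dν < ∞`. -/
def PhiIntegrablyOE {X Y : Type} [MeasurableSpace X] [MeasurableSpace Y]
    (μ : Measure X) (T : X ≃ᵐ X) (ν : Measure Y) (S : Y ≃ᵐ Y) (φ : ℝ → ℝ) : Prop :=
  ∃ Ψ : X ≃ᵐ Y, MeasurePreserving Ψ μ ν ∧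
    (∀ᵐ x ∂μ, Ψ '' orbit T x = orbit S (Ψ x)) ∧
    ∃ cT : X → ℤ, ∃ cS : Y → ℤ,
      Measurable cT ∧ Measurable cS ∧
      (∀ᵐ x ∂μ, Ψ (T x) = zIter S (cT x) (Ψ x)) ∧
      (∀ᵐ y ∂ν, Ψ.symm (S y) = zIter T (cS y) (Ψ.symm y)) ∧
      Integrable (fun x => φ |(cT x : ℝ)|) μ ∧
      Integrable (fun y => φ |(cS y : ℝ)|) ν

/-- The underlying space is a standard atomless probability space. -/
def MSystem.Standard (𝒮 : MSystem) : Prop :=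
  StandardBorelSpace 𝒮.carrier ∧ IsProbabilityMeasure 𝒮.μ ∧ NoAtoms 𝒮.μ

/-- `T` is φ-integrably orbit equivalent to the universal odometer. -/
def PhiOEToUnivOdometer {X : Type} [MeasurableSpace X] (μ : Measure X) (T : X ≃ᵐ X)
    (φ : ℝ → ℝ) : Prop :=
  ∃ 𝒮 : MSystem, 𝒮.Standard ∧ IsUniversalOdometer 𝒮.μ 𝒮.T ∧
    PhiIntegrablyOE μ T 𝒮.μ 𝒮.T φ

/-- `φ(t) = o(t^{1/3})` as `t → ∞`. -/
def SmallOCbrt (φ : ℝ → ℝ) : Prop :=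
  Tendsto (fun t : ℝ => φ t / t ^ ((1 : ℝ) / 3)) atTop (nhds 0)

/-- The height reached after applying a finite list of cutting and spacing parameters
(`h_n` for a list of length `n`). -/
def listHeight (L : List CSParam) : ℕ := L.foldl (fun h P => P.q * h + P.σtot) 1

/-- A class `𝒞` of systems is flexible: there is a set `F` of finite sequences of
cutting and spacing parameters such that (1) for some constant `C > 0`, every infinite
parameter sequence satisfying condition (F) all of whose initial segments lie in `F`
satisfies `Z_n ≤ C·h_n` for all `n`, and every rank-one system admitting a
cutting-and-stacking construction with these parameters belongs to `𝒞`; (2) `F`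
contains a length-one sequence with cutting parameter `≥ 3`; and (3) for some constant
`C' > 0`, every nonempty sequence of `F` (say of length `n`) can be extended inside `F`
by infinitely many choices of cutting parameter `q_n`, with spacing parameters
satisfying `σ_n ≤ C'·q_n·h_{n-1}`. -/
def IsFlexibleClass (𝒞 : MSystem → Prop) : Prop :=
  ∃ F : Set (List CSParam),
    (∃ C : ℝ, 0 < C ∧ ∀ p : ℕ → CSParam, CondF p →
      (∀ n : ℕ, (List.ofFn fun k : Fin (n + 1) => p k.val) ∈ F) →
      (∀ n, (Zmax p n : ℝ) ≤ C * (heights p n : ℝ)) ∧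
      ∀ 𝒮 : MSystem, 𝒮.Standard → IsRankOneWith 𝒮.μ 𝒮.T p → 𝒞 𝒮) ∧
    (∃ P : CSParam, [P] ∈ F ∧ 3 ≤ P.q) ∧
    (∃ C' : ℝ, 0 < C' ∧ ∀ L : List CSParam, L ∈ F → L ≠ [] →
      {q : ℕ | ∃ P : CSParam, P.q = q ∧
        (P.σtot : ℝ) ≤ C' * (q : ℝ) * (listHeight L.dropLast : ℝ) ∧
        L ++ [P] ∈ F}.Infinite)

/-- `T` is strongly mixing on `(X,μ)`: `|μ(A ∩ T⁻ⁿB) − μ(A)μ(B)| → 0` for all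
measurable `A`, `B`. -/
def StronglyMixing {X : Type} [MeasurableSpace X] (μ : MeasureTheory.Measure X)
    (T : X → X) : Prop :=
  ∀ A B : Set X, MeasurableSet A → MeasurableSet B →
    Filter.Tendsto
      (fun n : ℕ => |(μ (A ∩ T^[n] ⁻¹' B)).toReal - (μ A).toReal * (μ B).toReal|)
      Filter.atTop (nhds 0)

/-- Centered indicator of the event `a i = u, a (i + j) = v`. -/
noncomputable def pairTest (w : ℕ) (a : ℕ → ℕ) (j u v i : ℕ) : ℝ :=
  if a i = u then (if a (i + j) = v then 1 else 0) - 1 / (w : ℝ) else 0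

noncomputable def pairPotential (w J : ℕ) (c : ℝ) (n : ℕ) (a : ℕ → ℕ) : ℝ :=
  ∑ κ ∈ (Finset.Icc 1 J ×ˢ (Finset.range w ×ˢ Finset.range w)) ×ˢ ({c, -c} : Finset ℝ),
    Real.exp (κ.2 * ∑ i ∈ Finset.range (n - κ.1.1), pairTest w a κ.1.1 κ.1.2.1 κ.1.2.2 i)

lemma sum_exp_centered_le {w v : ℕ} (hv : v < w) {c : ℝ} (hc : |c| ≤ 1) :
    ∑ t ∈ Finset.range w, Real.exp (c * ((if t = v then 1 else 0) - 1 / (w : ℝ)))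
      ≤ w * Real.exp (c ^ 2) := by
  have hw : (1 : ℝ) ≤ w := by exact_mod_cast (by omega : 1 ≤ w)
  have hinv : 0 ≤ 1 / (w : ℝ) ∧ 1 / (w : ℝ) ≤ 1 :=
    ⟨by positivity, by rw [div_le_one (by linarith)]; exact hw⟩
  have key : ∀ t ∈ Finset.range w,
      Real.exp (c * ((if t = v then 1 else 0) - 1 / (w : ℝ)))
        ≤ c * ((if t = v then 1 else 0) - 1 / (w : ℝ)) + (1 + c ^ 2) := by
    intro t _
    set y : ℝ := (if t = v then 1 else 0) - 1 / (w : ℝ) with hy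
    have hy1 : |y| ≤ 1 := by
      rw [hy, abs_le]
      split_ifs <;> constructor <;> linarith [hinv.1, hinv.2]
    have hcy : |c * y| ≤ 1 := by
      rw [abs_mul]; exact mul_le_one₀ hc (abs_nonneg _) hy1
    have h1 := (abs_le.1 (Real.abs_exp_sub_one_sub_id_le hcy)).2
    have h2 : (c * y) ^ 2 ≤ c ^ 2 := by
      rw [mul_pow]
      exact mul_le_of_le_one_right (sq_nonneg c) ((sq_le_one_iff_abs_le_one y).2 hy1)
    linarith
  refine (Finset.sum_le_sum key).trans ?_
  rw [Finset.sum_add_distrib, ← Finset.mul_sum, Finset.sum_sub_distrib]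
  simp only [Finset.sum_ite_eq', Finset.mem_range, hv, if_true, Finset.sum_const,
    Finset.card_range, nsmul_eq_mul]
  have : (w : ℝ) * (1 / w) = 1 := by field_simp
  rw [this, sub_self, mul_zero, zero_add]
  exact mul_le_mul_of_nonneg_left (by linarith [Real.add_one_le_exp (c ^ 2)]) (by linarith)

lemma exists_pairPotential_le {w : ℕ} (hw : 0 < w) (J : ℕ) {c : ℝ} (hc : |c| ≤ 1) (n : ℕ) :
    ∃ a : ℕ → ℕ, (∀ i, a i < w) ∧
      pairPotential w J c n a ≤ 2 * (J * w ^ 2) * Real.exp (c ^ 2 * n) := by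
  induction n with
  | zero =>
    refine ⟨fun _ => 0, fun _ => hw, ?_⟩
    simp only [pairPotential, Nat.zero_sub, Finset.range_zero, Finset.sum_empty, mul_zero,
      Real.exp_zero, Finset.sum_const, Finset.card_product, Nat.card_Icc, Finset.card_range,
      nsmul_eq_mul, Nat.cast_zero, mul_one]
    have h2 : (({c, -c} : Finset ℝ).card : ℝ) ≤ 2 := by exact_mod_cast Finset.card_le_two
    push_cast [Nat.add_sub_cancel]
    nlinarith [mul_le_mul_of_nonneg_left h2 (by positivity : (0 : ℝ) ≤ J * (w * w))]
  | succ n ih =>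
    obtain ⟨a, ha, hΦ⟩ := ih
    have hstep : ∑ t ∈ Finset.range w, pairPotential w J c (n + 1) (Function.update a n t)
        ≤ ∑ t ∈ Finset.range w, Real.exp (c ^ 2) * pairPotential w J c n a := by
      simp only [pairPotential]
      rw [Finset.sum_comm, Finset.sum_const, Finset.card_range, nsmul_eq_mul, Finset.mul_sum,
        Finset.mul_sum]
      refine Finset.sum_le_sum ?_
      rintro ⟨⟨j, u, v⟩, d⟩ hκ
      simp only [Finset.mem_product, Finset.mem_Icc, Finset.mem_range, Finset.mem_insert,
        Finset.mem_singleton] at hκ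
      obtain ⟨⟨⟨hj1, hjJ⟩, hu, hv⟩, hd⟩ := hκ
      have hd2 : d ^ 2 = c ^ 2 := by rcases hd with rfl | rfl <;> ring
      have hd1 : |d| ≤ 1 := by rcases hd with rfl | rfl <;> simpa using hc
      have hold : ∀ t, ∑ i ∈ Finset.range (n - j), pairTest w (Function.update a n t) j u v i
          = ∑ i ∈ Finset.range (n - j), pairTest w a j u v i := by
        intro t
        refine Finset.sum_congr rfl fun i hi => ?_
        have := Finset.mem_range.1 hi
        simp only [pairTest]
        rw [Function.update_of_ne (by omega), Function.update_of_ne (by omega)]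
      simp only
      rcases lt_or_ge n j with hnj | hnj
      · have e1 : n + 1 - j = 0 := by omega
        have e2 : n - j = 0 := by omega
        simp only [e1, e2, Finset.range_zero, Finset.sum_empty, mul_zero, Real.exp_zero,
          Finset.sum_const, Finset.card_range, nsmul_eq_mul, mul_one]
        exact le_mul_of_one_le_right (by positivity) (Real.one_le_exp (sq_nonneg c))
      · have e1 : n + 1 - j = (n - j) + 1 := by omega
        have hterm : ∀ t, pairTest w (Function.update a n t) j u v (n - j)
            = if a (n - j) = u then (if t = v then 1 else 0) - 1 / (w : ℝ) else 0 := by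
          intro t
          simp only [pairTest]
          rw [Function.update_of_ne (by omega), Nat.sub_add_cancel hnj, Function.update_self]
        simp only [e1, Finset.sum_range_succ, hold, hterm, mul_add, Real.exp_add]
        rw [← Finset.mul_sum, mul_comm]
        rw [← mul_assoc]
        refine mul_le_mul_of_nonneg_right ?_ (Real.exp_pos _).le
        by_cases hau : a (n - j) = u
        · simp only [hau, if_true]
          rw [← hd2]
          exact sum_exp_centered_le hv hd1
        · simp only [hau, if_false, mul_zero, Real.exp_zero, Finset.sum_const, Finset.card_range,
            nsmul_eq_mul, mul_one]
          exact le_mul_of_one_le_right (by positivity) (Real.one_le_exp (sq_nonneg c))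
    obtain ⟨t, ht, hle⟩ := Finset.exists_le_of_sum_le ⟨0, Finset.mem_range.2 hw⟩ hstep
    refine ⟨Function.update a n t, fun i => ?_, hle.trans ?_⟩
    · rcases eq_or_ne i n with rfl | hi
      · rw [Function.update_self]; exact Finset.mem_range.1 ht
      · rw [Function.update_of_ne hi]; exact ha i
    · refine (mul_le_mul_of_nonneg_left hΦ (Real.exp_pos _).le).trans (le_of_eq ?_)
      push_cast
      rw [mul_add, mul_one, Real.exp_add]
      ring

/-- For every large `q` there is a word of length `q` over `{0, …, w-1}` all of whose pairs of
positions at a fixed distance have almost independent letters. -/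
lemma eventually_exists_word {w : ℕ} (hw : 0 < w) {δ : ℝ} (hδ : 0 < δ) (hδ1 : δ ≤ 1) :
    ∀ᶠ q : ℕ in Filter.atTop, ∃ a : ℕ → ℕ, (∀ i, a i < w) ∧
      ∀ j, 1 ≤ j → j < q → ∀ u < w, ∀ v < w,
        |∑ i ∈ Finset.range (q - j), pairTest w a j u v i| ≤ δ * q := by
  have hlim : Filter.Tendsto (fun q : ℕ => Real.exp (δ ^ 2 / 4 * q) / (q : ℝ))
      Filter.atTop Filter.atTop := by
    have h := (tendsto_exp_mul_div_rpow_atTop 1 (δ ^ 2 / 4) (by positivity)).comp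
      tendsto_natCast_atTop_atTop
    simpa [Function.comp_def] using h
  filter_upwards [hlim.eventually_ge_atTop (2 * (w : ℝ) ^ 2), Filter.eventually_ge_atTop 1]
    with q hq hq1
  have hq0 : (0 : ℝ) < q := by exact_mod_cast hq1
  rw [le_div_iff₀ hq0] at hq
  have hc : |δ / 2| ≤ 1 := by rw [abs_of_pos (by positivity)]; linarith
  obtain ⟨a, ha, hΦ⟩ := exists_pairPotential_le hw q hc q
  refine ⟨a, ha, fun j hj hjq u hu v hv => ?_⟩
  have hbound : ∀ d : ℝ, (d = δ / 2 ∨ d = -(δ / 2)) →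
      d * ∑ i ∈ Finset.range (q - j), pairTest w a j u v i ≤ δ / 2 * (δ * q) := by
    intro d hd
    rw [← Real.exp_le_exp]
    have hmem : (((j, u, v), d) : (ℕ × ℕ × ℕ) × ℝ) ∈
        (Finset.Icc 1 q ×ˢ (Finset.range w ×ˢ Finset.range w)) ×ˢ
          ({δ / 2, -(δ / 2)} : Finset ℝ) := by
      simp only [Finset.mem_product, Finset.mem_Icc, Finset.mem_range, Finset.mem_insert,
        Finset.mem_singleton]
      exact ⟨⟨⟨hj, hjq.le⟩, hu, hv⟩, hd⟩
    have h1 := Finset.single_le_sum (f := fun κ : (ℕ × ℕ × ℕ) × ℝ => Real.exp (κ.2 *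
      ∑ i ∈ Finset.range (q - κ.1.1), pairTest w a κ.1.1 κ.1.2.1 κ.1.2.2 i))
      (fun κ _ => (Real.exp_pos _).le) hmem
    refine h1.trans (hΦ.trans ?_)
    have h2 : δ / 2 * (δ * q) = δ ^ 2 / 4 * q + (δ / 2) ^ 2 * q := by ring
    rw [h2, Real.exp_add]
    refine mul_le_mul_of_nonneg_right ?_ (Real.exp_pos _).le
    linarith
  rw [abs_le]
  have h1 := hbound _ (Or.inl rfl)
  have h2 := hbound _ (Or.inr rfl)
  constructor <;> nlinarith

/-- The `m`-th step places its columns at heights `i (h + m + 1) + a i`, where `a` is a word over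
`{0, …, m}` with nearly independent pairs of letters at every fixed distance. -/
structure IsOrnsteinStep (m : ℕ) (P : CSParam) (a : ℕ → ℕ) : Prop where
  lt : ∀ i, a i < m + 1
  spacer_zero : P.σ 0 = a 0
  spacer_succ : ∀ i, i + 1 < P.q → P.σ (i + 1) + a i = m + 1 + a (i + 1)
  spacer_last : P.σ P.q + a (P.q - 1) = m + 1
  le_q : m + 1 ≤ P.q
  pair_bound : ∀ j, 1 ≤ j → j < P.q → ∀ u < m + 1, ∀ v < m + 1,
    |∑ i ∈ Finset.range (P.q - j), pairTest (m + 1) a j u v i|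
      ≤ 1 / ((m + 1 : ℕ) : ℝ) ^ 3 * P.q

namespace IsOrnsteinStep
variable {m : ℕ} {P : CSParam} {a : ℕ → ℕ}

lemma sum_spacers (h : IsOrnsteinStep m P a) (i : ℕ) (hi : i < P.q) :
    ∑ j ∈ Finset.range (i + 1), P.σ j = i * (m + 1) + a i := by
  induction i with
  | zero => simp [h.spacer_zero]
  | succ i ih =>
    rw [Finset.sum_range_succ, ih (by omega)]
    have := h.spacer_succ i hi
    rw [add_mul]
    omega

lemma σtot_eq (h : IsOrnsteinStep m P a) : P.σtot = P.q * (m + 1) := by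
  have h2 := P.two_le_q
  have h1 := h.sum_spacers (P.q - 1) (by omega)
  rw [Nat.sub_add_cancel (by omega)] at h1
  rw [CSParam.σtot, Finset.sum_range_succ, h1, add_assoc, add_comm (a _), h.spacer_last]
  conv_rhs => rw [← Nat.sub_add_cancel (by omega : 1 ≤ P.q)]
  ring

lemma σ_le (h : IsOrnsteinStep m P a) (i : ℕ) : P.σ i ≤ 2 * (m + 1) := by
  rcases lt_trichotomy i P.q with hi | rfl | hi
  · cases i with
    | zero => rw [h.spacer_zero]; have := h.lt 0; omega
    | succ i => have := h.spacer_succ i hi; have := h.lt (i + 1); omega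
  · have := h.spacer_last; omega
  · rw [P.σ_eq_zero_of_gt i hi]; omega

end IsOrnsteinStep

lemma eventually_exists_isOrnsteinStep (m : ℕ) :
    ∀ᶠ q : ℕ in Filter.atTop, ∃ P : CSParam, P.q = q ∧ ∃ a, IsOrnsteinStep m P a := by
  have hm : (1 : ℝ) ≤ ((m + 1 : ℕ) : ℝ) := by exact_mod_cast (by omega : 1 ≤ m + 1)
  have h1 : 1 / ((m + 1 : ℕ) : ℝ) ^ 3 ≤ 1 := by
    rw [div_le_one (by positivity)]; exact one_le_pow₀ hm
  filter_upwards [eventually_exists_word (w := m + 1) (by omega)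
    (δ := 1 / ((m + 1 : ℕ) : ℝ) ^ 3) (by positivity) h1,
    Filter.eventually_ge_atTop (m + 2)] with q ⟨a, ha, hcorr⟩ hq
  refine ⟨⟨q, by omega, fun i => if i = 0 then a 0 else if i < q then m + 1 + a i - a (i - 1)
    else if i = q then m + 1 - a (q - 1) else 0, ?_⟩, rfl, a, ⟨ha, ?_, ?_, ?_, ?_, ?_⟩⟩
  · intro i hi
    rw [if_neg (by omega), if_neg (by omega), if_neg (by omega)]
  · simp
  · intro i hi
    have := ha i
    simp only [Nat.add_sub_cancel, if_neg (Nat.succ_ne_zero i)] at hi ⊢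
    rw [if_pos hi]
    omega
  · have := ha (q - 1)
    simp only [lt_irrefl, if_false, if_true]
    rw [if_neg (by omega)]
    omega
  · simp only; omega
  · exact hcorr

lemma two_pow_le_heights (p : ℕ → CSParam) (n : ℕ) : 2 ^ n ≤ heights p n := by
  induction n with
  | zero => simp [heights]
  | succ n ih =>
    have := (p n).two_le_q
    rw [heights, pow_succ, mul_comm]
    exact (Nat.mul_le_mul this ih).trans (Nat.le_add_right _ _)

lemma two_pow_le_listHeight (L : List CSParam) : 2 ^ L.length ≤ listHeight L := by
  induction L using List.reverseRecOn with
  | nil => simp [listHeight]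
  | append_singleton L P ih =>
    have := P.two_le_q
    simp only [listHeight, List.foldl_append, List.foldl_cons, List.foldl_nil,
      List.length_append, List.length_singleton] at ih ⊢
    rw [pow_succ, mul_comm]
    exact (Nat.mul_le_mul this ih).trans (Nat.le_add_right _ _)

lemma heights_strictMono (p : ℕ → CSParam) : StrictMono (heights p) := by
  refine strictMono_nat_of_lt_succ fun n => ?_
  have h2 := (p n).two_le_q
  have h0 : 0 < heights p n := (pow_pos two_pos n).trans_le (two_pow_le_heights p n)
  rw [heights]
  nlinarith

lemma Zmax_le_of_isOrnsteinStep {p : ℕ → CSParam} (hp : ∀ m, ∃ a, IsOrnsteinStep m (p m) a)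
    (n : ℕ) : Zmax p n ≤ 2 * heights p n := by
  refine Finset.sup_le fun j hj => Finset.sup_le fun i _ => ?_
  obtain ⟨a, ha⟩ := hp j
  have h1 := ha.σ_le i
  have h2 : n + 1 ≤ 2 ^ n := Nat.lt_two_pow_self
  have h3 := two_pow_le_heights p n
  have := Finset.mem_range.1 hj
  omega

lemma flexible_of_isOrnsteinStep {𝒞 : MSystem → Prop}
    (h𝒞 : ∀ p : ℕ → CSParam, (∀ m, ∃ a, IsOrnsteinStep m (p m) a) → ∀ 𝒮 : MSystem,
      𝒮.Standard → IsRankOneWith 𝒮.μ 𝒮.T p → 𝒞 𝒮) : IsFlexibleClass 𝒞 := by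
  refine ⟨{L | ∀ m (hm : m < L.length), ∃ a, IsOrnsteinStep m L[m] a}, ⟨2, two_pos, ?_⟩, ?_,
    2, two_pos, ?_⟩
  · intro p _ hF
    have hp : ∀ m, ∃ a, IsOrnsteinStep m (p m) a := fun m => by
      obtain ⟨a, ha⟩ := hF m m (by simp)
      rw [List.getElem_ofFn] at ha
      exact ⟨a, ha⟩
    exact ⟨fun n => by exact_mod_cast Zmax_le_of_isOrnsteinStep hp n, h𝒞 p hp⟩
  · obtain ⟨q, ⟨P, rfl, a, ha⟩, hq⟩ := ((eventually_exists_isOrnsteinStep 0).and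
      (Filter.eventually_ge_atTop 3)).exists
    refine ⟨P, fun m hm => ?_, hq⟩
    obtain rfl : m = 0 := by simpa using hm
    exact ⟨a, ha⟩
  · intro L hL hne
    refine ((Nat.frequently_atTop_iff_infinite).1
      (eventually_exists_isOrnsteinStep L.length).frequently).mono ?_
    rintro q ⟨P, rfl, a, ha⟩
    refine ⟨P, rfl, ?_, fun m hm => ?_⟩
    · rw [ha.σtot_eq]
      have h0 : 0 < L.length := List.length_pos_iff.2 hne
      have h1 := two_pow_le_listHeight L.dropLast
      rw [List.length_dropLast] at h1
      have h2 : L.length - 1 + 1 ≤ 2 ^ (L.length - 1) := Nat.lt_two_pow_self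
      have h3 : L.length + 1 ≤ 2 * listHeight L.dropLast := by omega
      have h4 : P.q * (L.length + 1) ≤ 2 * P.q * listHeight L.dropLast := by nlinarith
      exact_mod_cast h4
    · rcases Nat.lt_or_ge m L.length with h | h
      · rw [List.getElem_append_left h]; exact hL m h
      · have hm' : m = L.length := by simp at hm; omega
        subst hm'
        simpa using ⟨a, ha⟩

/-- The `L¹` deviation of the Cesàro averages of the indicator of `C` along `T`. -/
noncomputable def cesaroDeviation {X : Type} [MeasurableSpace X] (μ : Measure X) (T : X → X)
    (C : Set X) (w : ℕ) : ℝ :=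
  ∫ x, |(w : ℝ)⁻¹ * ∑ v ∈ Finset.range w, C.indicator 1 (T^[v] x) - μ.real C| ∂μ

section MeanErgodic
variable {X : Type} [MeasurableSpace X] {μ : Measure X} [IsProbabilityMeasure μ]

lemma integral_abs_le_norm_Lp_two (F : Lp ℝ 2 μ) : ∫ x, |F x| ∂μ ≤ ‖F‖ := by
  have h1 : ∫ x, |F x| ∂μ = (eLpNorm F 1 μ).toReal := by
    rw [eLpNorm_one_eq_lintegral_enorm,
      ← integral_norm_eq_lintegral_enorm (Lp.aestronglyMeasurable F)]
    rfl
  rw [h1, Lp.norm_def]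
  exact ENNReal.toReal_mono (Lp.eLpNorm_ne_top F)
    (eLpNorm_le_eLpNorm_of_exponent_le (by norm_num) (Lp.aestronglyMeasurable F))

lemma Ergodic.tendsto_cesaroDeviation {T : X → X} (hT : Ergodic T μ) {C : Set X}
    (hC : MeasurableSet C) :
    Tendsto (cesaroDeviation μ T C) atTop (𝓝 0) := by
  have hmp := hT.toMeasurePreserving
  let U : Lp ℝ 2 μ →L[ℝ] Lp ℝ 2 μ :=
    (Lp.compMeasurePreservingₗᵢ ℝ T hmp).toContinuousLinearMap
  let f : Lp ℝ 2 μ := indicatorConstLp 2 hC (measure_ne_top μ C) (1 : ℝ)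
  have hlim := U.tendsto_birkhoffAverage_orthogonalProjection
    (LinearIsometry.norm_toContinuousLinearMap_le _) f
  set G := (U.eqLocus (1 : Lp ℝ 2 μ →L[ℝ] Lp ℝ 2 μ)).orthogonalProjectionOnto f
  obtain ⟨g, hg⟩ := G
  have hUg : Lp.compMeasurePreserving T hmp g = g := hg
  obtain ⟨c, hc⟩ : ∃ c, g =ᵐ[μ] Function.const X c := by
    refine hT.ae_eq_const_of_ae_eq_comp_ae (Lp.aestronglyMeasurable g) ?_
    have := Lp.coeFn_compMeasurePreserving g hmp
    rw [hUg] at this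
    exact this.symm
  have hcoe : ∀ n, (birkhoffAverage ℝ U _root_.id n f : Lp ℝ 2 μ) =ᵐ[μ]
      fun x => (n : ℝ)⁻¹ * ∑ v ∈ Finset.range n, C.indicator 1 (T^[v] x) := by
    intro n
    have hsum : (birkhoffSum U _root_.id n f : Lp ℝ 2 μ) =ᵐ[μ]
        fun x => ∑ v ∈ Finset.range n, C.indicator (1 : X → ℝ) (T^[v] x) := by
      induction n with
      | zero =>
        simp only [birkhoffSum_zero, Finset.range_zero, Finset.sum_empty]
        exact Lp.coeFn_zero _ _ _
      | succ n ih =>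
        rw [birkhoffSum_succ]
        have hit : (U^[n] f : Lp ℝ 2 μ) = Lp.compMeasurePreserving T^[n] (hmp.iterate n) f := by
          rw [← Lp.compMeasurePreserving_iterate]; rfl
        filter_upwards [Lp.coeFn_add (birkhoffSum U _root_.id n f) (_root_.id (U^[n] f)), ih,
          Lp.coeFn_compMeasurePreserving f (hmp.iterate n),
          (hmp.iterate n).quasiMeasurePreserving.ae
            (indicatorConstLp_coeFn (p := 2) (hs := hC) (hμs := measure_ne_top μ C)
              (c := (1 : ℝ)))] with x h1 h2 h3 h4
        rw [h1, Pi.add_apply, h2, Finset.sum_range_succ, id, hit, h3, Function.comp_apply, h4]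
        rfl
    filter_upwards [Lp.coeFn_smul (n : ℝ)⁻¹ (birkhoffSum U _root_.id n f), hsum] with x h1 h2
    rw [birkhoffAverage, h1, Pi.smul_apply, h2, smul_eq_mul]
  have hdiff : ∀ n : ℕ, (fun x => (n : ℝ)⁻¹ * ∑ v ∈ Finset.range n, C.indicator 1 (T^[v] x) - c)
      =ᵐ[μ] (birkhoffAverage ℝ U _root_.id n f - g : Lp ℝ 2 μ) := by
    intro n
    filter_upwards [hcoe n, hc, Lp.coeFn_sub (birkhoffAverage ℝ U _root_.id n f) g] with x h1 h2 h3
    rw [h3, Pi.sub_apply, h1, h2]; rfl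
  have hbound : ∀ n : ℕ, ∫ x, |(n : ℝ)⁻¹ * ∑ v ∈ Finset.range n, C.indicator 1 (T^[v] x) - c| ∂μ
      ≤ ‖birkhoffAverage ℝ U _root_.id n f - g‖ := by
    intro n
    refine (integral_congr_ae ?_).trans_le (integral_abs_le_norm_Lp_two _)
    filter_upwards [hdiff n] with x hx
    rw [hx]
  have hnorm : Tendsto (fun n => ‖birkhoffAverage ℝ U _root_.id n f - g‖) atTop (𝓝 0) :=
    tendsto_iff_norm_sub_tendsto_zero.1 hlim
  have hL1 : Tendsto (fun n : ℕ => ∫ x, |(n : ℝ)⁻¹ *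
      ∑ v ∈ Finset.range n, C.indicator 1 (T^[v] x) - c| ∂μ) atTop (𝓝 0) :=
    squeeze_zero (fun n => integral_nonneg fun x => abs_nonneg _) hbound hnorm
  have hint : ∀ v, Integrable (fun x => C.indicator (1 : X → ℝ) (T^[v] x)) μ := fun v =>
    (hmp.iterate v).integrable_comp_of_integrable
      ((integrable_const (1 : ℝ)).indicator hC)
  have hintegral : ∀ v, ∫ x, C.indicator (1 : X → ℝ) (T^[v] x) ∂μ = μ.real C := by
    intro v
    have h1 : (fun x => C.indicator (1 : X → ℝ) (T^[v] x)) = (T^[v] ⁻¹' C).indicator 1 := rfl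
    rw [h1, integral_indicator_one ((hmp.iterate v).measurable hC),
      (hmp.iterate v).measureReal_preimage hC.nullMeasurableSet]
  have hcC : c = μ.real C := by
    have hle : ∀ᶠ n : ℕ in atTop, |μ.real C - c| ≤ ∫ x, |(n : ℝ)⁻¹ *
        ∑ v ∈ Finset.range n, C.indicator 1 (T^[v] x) - c| ∂μ := by
      filter_upwards [eventually_gt_atTop 0] with n hn
      have hmean : ∫ x, ((n : ℝ)⁻¹ * ∑ v ∈ Finset.range n, C.indicator (1 : X → ℝ) (T^[v] x) - c) ∂μ
          = μ.real C - c := by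
        rw [integral_sub ((integrable_finsetSum _ fun v _ => hint v).const_mul _)
          (integrable_const _), integral_const_mul, integral_finsetSum _ fun v _ => hint v]
        simp only [hintegral, Finset.sum_const, Finset.card_range, nsmul_eq_mul, integral_const,
          probReal_univ, one_smul]
        have : (n : ℝ) ≠ 0 := by positivity
        field_simp
      rw [← hmean]
      exact abs_integral_le_integral_abs
    have := ge_of_tendsto hL1 hle
    have h0 := abs_nonpos_iff.1 this
    linarith
  rw [hcC] at hL1
  exact hL1

end MeanErgodic

section IterateImage
variable {X : Type} [MeasurableSpace X] {μ : Measure X} {T : X ≃ᵐ X}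

lemma image_iterate_add (k l : ℕ) (S : Set X) :
    (⇑T)^[k + l] '' S = (⇑T)^[k] '' ((⇑T)^[l] '' S) := by
  rw [Function.iterate_add, image_comp]

lemma measurableSet_image_iterate (k : ℕ) {S : Set X} (hS : MeasurableSet S) :
    MeasurableSet ((⇑T)^[k] '' S) := by
  induction k with
  | zero => simpa using hS
  | succ k ih =>
    rw [Function.iterate_succ', image_comp]
    exact (T.measurableSet_image).2 ih

lemma measureReal_image_iterate (hT : MeasurePreserving T μ μ) (k : ℕ) {S : Set X}
    (hS : MeasurableSet S) : μ.real ((⇑T)^[k] '' S) = μ.real S := by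
  rw [← (hT.iterate k).measureReal_preimage (measurableSet_image_iterate k hS).nullMeasurableSet,
    preimage_image_eq _ (T.injective.iterate k)]

lemma disjoint_image_iterate_add {k l : ℕ} (m : ℕ) {S R : Set X} :
    Disjoint ((⇑T)^[m + k] '' S) ((⇑T)^[m + l] '' R) ↔
      Disjoint ((⇑T)^[k] '' S) ((⇑T)^[l] '' R) := by
  rw [image_iterate_add, image_iterate_add, disjoint_image_iff (T.injective.iterate m)]

end IterateImage

lemma colStart_add_lt_heights (p : ℕ → CSParam) {n i k : ℕ} (hi : i < (p n).q)
    (hk : k < heights p n) : colStart p n i + k < heights p (n + 1) := by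
  have h1 : ∑ j ∈ Finset.range (i + 1), (p n).σ j ≤ (p n).σtot :=
    Finset.sum_le_sum_of_subset (Finset.range_mono (by omega))
  have h2 : (i + 1) * heights p n ≤ (p n).q * heights p n := Nat.mul_le_mul_right _ hi
  rw [colStart, heights]
  rw [add_mul] at h2
  omega

lemma heights_pos (p : ℕ → CSParam) (n : ℕ) : 0 < heights p n :=
  (Nat.two_pow_pos n).trans_le (two_pow_le_heights p n)

namespace IsCuttingStacking
variable {X : Type} [MeasurableSpace X] {μ : Measure X} {T : X ≃ᵐ X} {p : ℕ → CSParam}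
  {B : ℕ → Set X} {Bsub : ℕ → ℕ → Set X}

lemma measurableSet_level (h : IsCuttingStacking T p B Bsub) (n k : ℕ) :
    MeasurableSet ((⇑T)^[k] '' B n) :=
  measurableSet_image_iterate k (h.meas_base n)

lemma sub_eq (h : IsCuttingStacking T p B Bsub) {n i : ℕ} (hi : i < (p n).q) :
    Bsub n i = (⇑T)^[colStart p n i] '' B (n + 1) := by
  have := h.subcolumn n i hi 0 (heights_pos p n)
  simpa using this.symm

lemma sub_subset (h : IsCuttingStacking T p B Bsub) {n i : ℕ} (hi : i < (p n).q) :
    Bsub n i ⊆ B n := by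
  rw [h.union_sub n]
  exact subset_biUnion_of_mem (u := fun i => Bsub n i) (Finset.mem_range.2 hi)

lemma level_subset_towerUnion {n k : ℕ} (hk : k < heights p n) :
    (⇑T)^[k] '' B n ⊆ towerUnion T p B n :=
  subset_biUnion_of_mem (u := fun k => (⇑T)^[k] '' B n) (Finset.mem_range.2 hk)

lemma towerUnion_mono (h : IsCuttingStacking T p B Bsub) : Monotone (towerUnion T p B) := by
  refine monotone_nat_of_le_succ fun n => iUnion₂_subset fun k hk => ?_
  rw [Finset.mem_range] at hk
  rw [h.union_sub n, image_iUnion₂]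
  refine iUnion₂_subset fun i hi => ?_
  rw [Finset.mem_range] at hi
  rw [← h.subcolumn n i hi k hk]
  exact level_subset_towerUnion (colStart_add_lt_heights p hi hk)

lemma level_subset_or_disjoint (h : IsCuttingStacking T p B Bsub) {n N : ℕ} (hnN : n ≤ N)
    {k l : ℕ} (hk : k < heights p n) (hl : l < heights p N) :
    (⇑T)^[l] '' B N ⊆ (⇑T)^[k] '' B n ∨ Disjoint ((⇑T)^[l] '' B N) ((⇑T)^[k] '' B n) := by
  induction N, hnN using Nat.le_induction generalizing l with
  | base =>
    by_cases hlk : l = k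
    · exact Or.inl (by rw [hlk])
    · exact Or.inr (h.disj_levels n l hl k hk hlk)
  | succ N hN ih =>
    by_cases hex : ∃ i < (p N).q, ∃ k' < heights p N, l = colStart p N i + k'
    · obtain ⟨i, hi, k', hk', rfl⟩ := hex
      rw [h.subcolumn N i hi k' hk']
      have hsub := image_mono (f := (⇑T)^[k']) (h.sub_subset hi)
      exact (ih hk').imp hsub.trans fun hd => hd.mono_left hsub
    · push Not at hex
      exact Or.inr ((h.spacer_disjoint N l hl hex).mono_right
        ((level_subset_towerUnion hk).trans (h.towerUnion_mono hN)))

lemma isPiSystem_levels (h : IsCuttingStacking T p B Bsub) :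
    IsPiSystem {s : Set X | ∃ n k, k < heights p n ∧ s = (⇑T)^[k] '' B n} := by
  rintro s ⟨n, k, hk, rfl⟩ t ⟨N, l, hl, rfl⟩ hne
  rw [← not_disjoint_iff_nonempty_inter] at hne
  rcases le_total n N with hle | hle
  · rw [disjoint_comm] at hne
    rw [inter_eq_self_of_subset_right
      ((h.level_subset_or_disjoint hle hk hl).resolve_right hne)]
    exact ⟨N, l, hl, rfl⟩
  · rw [inter_eq_self_of_subset_left
      ((h.level_subset_or_disjoint hle hl hk).resolve_right hne)]
    exact ⟨n, k, hk, rfl⟩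

/-- A property stable under complements, countable disjoint unions and modification on null sets
holds for all measurable sets as soon as it holds for the levels of the towers. -/
lemma induction_on_levels (h : IsCuttingStacking T p B Bsub) (hgen : TowersGenerate μ T p B)
    {P : Set X → Prop} (hempty : P ∅)
    (hlevel : ∀ n k, k < heights p n → P ((⇑T)^[k] '' B n))
    (hcompl : ∀ A, MeasurableSet A → P A → P Aᶜ)
    (hUnion : ∀ f : ℕ → Set X, Pairwise (Function.onFun Disjoint f) →
      (∀ i, MeasurableSet (f i)) → (∀ i, P (f i)) → P (⋃ i, f i))
    (hcongr : ∀ A A' : Set X, A =ᵐ[μ] A' → P A' → P A) {A : Set X}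
    (hA : MeasurableSet A) : P A := by
  obtain ⟨A', hA', hAA'⟩ := hgen A hA
  refine hcongr A A' (measure_symmDiff_eq_zero_iff.1 hAA') ?_
  set 𝓛 := {s : Set X | ∃ n k, k < heights p n ∧ s = (⇑T)^[k] '' B n}
  have hle : MeasurableSpace.generateFrom 𝓛 ≤ ‹MeasurableSpace X› := by
    refine MeasurableSpace.generateFrom_le ?_
    rintro s ⟨n, k, -, rfl⟩
    exact h.measurableSet_level n k
  refine MeasurableSpace.induction_on_inter (m := MeasurableSpace.generateFrom 𝓛)
    (C := fun s _ => P s) rfl h.isPiSystem_levels hempty ?_ ?_ ?_ A' hA'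
  · rintro s ⟨n, k, hk, rfl⟩
    exact hlevel n k hk
  · exact fun s hs => hcompl s (hle s hs)
  · exact fun f hd hf => hUnion f hd fun i => hle _ (hf i)

lemma ae_mem_iUnion_towerUnion [StandardBorelSpace X] [NullSingletonClass μ]
    (h : IsCuttingStacking T p B Bsub) (hgen : TowersGenerate μ T p B) :
    ∀ᵐ x ∂μ, x ∈ ⋃ n, towerUnion T p B n := by
  set Y := ⋃ n, towerUnion T p B n
  have hYm : MeasurableSet Y := .iUnion fun n =>
    Finset.measurableSet_biUnion _ fun k _ => h.measurableSet_level n k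
  have hdich : ∀ A, MeasurableSet A → μ (A ∩ Yᶜ) = 0 ∨ μ (Aᶜ ∩ Yᶜ) = 0 := by
    intro A hA
    refine h.induction_on_levels hgen (P := fun A => μ (A ∩ Yᶜ) = 0 ∨ μ (Aᶜ ∩ Yᶜ) = 0)
      ?_ ?_ ?_ ?_ ?_ hA
    · simp
    · intro n k hk
      left
      have : (⇑T)^[k] '' B n ⊆ Y := (level_subset_towerUnion hk).trans (subset_iUnion _ n)
      rw [(disjoint_compl_right_iff_subset.2 this).inter_eq, measure_empty]
    · rintro A - (hA | hA)
      · right; rwa [compl_compl]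
      · left; exact hA
    · intro f _ _ hf
      by_cases hex : ∃ i, μ ((f i)ᶜ ∩ Yᶜ) = 0
      · obtain ⟨i, hi⟩ := hex
        right
        exact measure_mono_null
          (inter_subset_inter_left _ (compl_subset_compl.2 (subset_iUnion f i))) hi
      · push Not at hex
        left
        rw [iUnion_inter, measure_iUnion_null_iff]
        exact fun i => (hf i).resolve_right (hex i)
    · intro A A' hAA' hA'
      have h1 : μ (A ∩ Yᶜ) = μ (A' ∩ Yᶜ) := measure_congr (hAA'.inter (ae_eq_refl Yᶜ))
      have h2 : μ (Aᶜ ∩ Yᶜ) = μ (A'ᶜ ∩ Yᶜ) := measure_congr (hAA'.compl.inter (ae_eq_refl Yᶜ))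
      rwa [h1, h2]
  by_contra hpos
  have hne : (ae (μ.restrict Yᶜ)).NeBot := by
    rw [ae_neBot, Ne, Measure.restrict_eq_zero]
    exact hpos
  obtain ⟨t, -, ht, htmem⟩ := Filter.exists_subset_subsingleton_mem_of_forall_separating
    (l := ae (μ.restrict Yᶜ)) MeasurableSet (s := univ) univ_mem fun U hU => by
      rcases hdich U hU with h0 | h0
      · right
        rw [mem_ae_iff, compl_compl, Measure.restrict_apply hU, h0]
      · left
        rw [mem_ae_iff, Measure.restrict_apply hU.compl, h0]
  have h0 : μ.restrict Yᶜ t = 0 :=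
    Measure.restrict_le_self.absolutelyContinuous (ht.measure_zero μ)
  obtain ⟨x, hx, hx'⟩ := Filter.nonempty_of_mem (inter_mem htmem (compl_mem_ae_iff.2 h0))
  exact hx' hx

end IsCuttingStacking

lemma measureReal_image_iterate_inter {X : Type} [MeasurableSpace X] {μ : Measure X} {T : X ≃ᵐ X}
    (hT : MeasurePreserving T μ μ) (k : ℕ) {S E : Set X}
    (hS : MeasurableSet S) (hE : MeasurableSet E) (hinv : T ⁻¹' E = E) :
    μ.real ((⇑T)^[k] '' S ∩ E) = μ.real (S ∩ E) := by
  have hk : (⇑T)^[k] ⁻¹' E = E := by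
    induction k with
    | zero => rfl
    | succ k ih => rw [Function.iterate_succ, preimage_comp, ih, hinv]
  rw [← image_inter_preimage, hk, measureReal_image_iterate hT k (hS.inter hE)]

lemma hasSum_measureReal_iUnion {X : Type} [MeasurableSpace X] {μ : Measure X} [IsFiniteMeasure μ]
    {f : ℕ → Set X} (hf : ∀ i, MeasurableSet (f i)) (hd : Pairwise (Function.onFun Disjoint f)) :
    HasSum (fun i => μ.real (f i)) (μ.real (⋃ i, f i)) := by
  rw [measureReal_def, measure_iUnion hd hf, ENNReal.tsum_toReal_eq fun i => measure_ne_top μ _]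
  exact ENNReal.hasSum_toReal (by rw [← measure_iUnion hd hf]; exact measure_ne_top μ _)

namespace IsCuttingStacking
variable {X : Type} [MeasurableSpace X] {μ : Measure X} [IsProbabilityMeasure μ] {T : X ≃ᵐ X}
  {p : ℕ → CSParam} {B : ℕ → Set X} {Bsub : ℕ → ℕ → Set X}

lemma measureReal_base_inter (h : IsCuttingStacking T p B Bsub) (hT : MeasurePreserving T μ μ)
    {E : Set X} (hE : MeasurableSet E) (hinv : T ⁻¹' E = E) (n : ℕ) :
    μ.real (B n ∩ E) = (p n).q * μ.real (B (n + 1) ∩ E) := by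
  rw [h.union_sub n, iUnion₂_inter, measureReal_biUnion_finset]
  · rw [Finset.sum_congr rfl fun i hi => ?_, Finset.sum_const, Finset.card_range, nsmul_eq_mul]
    rw [h.sub_eq (Finset.mem_range.1 hi),
      measureReal_image_iterate_inter hT _ (h.meas_base _) hE hinv]
  · intro i hi j hj hij
    exact (h.disj_sub n i (by simpa using hi) j (by simpa using hj) hij).mono
      inter_subset_left inter_subset_left
  · exact fun i hi => (h.meas_sub n i (Finset.mem_range.1 hi)).inter hE

lemma measureReal_base (h : IsCuttingStacking T p B Bsub) (hT : MeasurePreserving T μ μ) (n : ℕ) :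
    μ.real (B n) = (p n).q * μ.real (B (n + 1)) := by
  simpa using h.measureReal_base_inter hT MeasurableSet.univ preimage_univ n

lemma measureReal_towerUnion_inter (h : IsCuttingStacking T p B Bsub)
    (hT : MeasurePreserving T μ μ) {E : Set X} (hE : MeasurableSet E) (hinv : T ⁻¹' E = E) (n : ℕ) :
    μ.real (towerUnion T p B n ∩ E) = heights p n * μ.real (B n ∩ E) := by
  rw [towerUnion, iUnion₂_inter, measureReal_biUnion_finset]
  · rw [Finset.sum_congr rfl fun k _ =>
      measureReal_image_iterate_inter hT k (h.meas_base n) hE hinv]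
    simp
  · intro i hi j hj hij
    exact (h.disj_levels n i (by simpa using hi) j (by simpa using hj) hij).mono
      inter_subset_left inter_subset_left
  · exact fun k _ => (h.measurableSet_level n k).inter hE

lemma heights_mul_measureReal_base_le (h : IsCuttingStacking T p B Bsub)
    (hT : MeasurePreserving T μ μ) (n : ℕ) : heights p n * μ.real (B n) ≤ 1 := by
  have := h.measureReal_towerUnion_inter hT MeasurableSet.univ preimage_univ n
  rw [inter_univ, inter_univ] at this
  rw [← this]
  exact measureReal_le_one

lemma ergodic [StandardBorelSpace X] [NullSingletonClass μ] (h : IsCuttingStacking T p B Bsub)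
    (hgen : TowersGenerate μ T p B) (hT : MeasurePreserving T μ μ) : Ergodic T μ := by
  refine ⟨hT, ⟨fun {E} hE hinv => ?_⟩⟩
  have hbase : ∀ n, μ.real (B n ∩ E) * μ.real (B 0) = μ.real (B 0 ∩ E) * μ.real (B n) := by
    intro n
    induction n with
    | zero => rfl
    | succ n ih =>
      have hq : ((p n).q : ℝ) ≠ 0 := by have := (p n).two_le_q; positivity
      rw [h.measureReal_base_inter hT hE hinv n, h.measureReal_base hT n] at ih
      refine mul_left_cancel₀ hq ?_
      linarith
  have hYlim : ∀ F, Tendsto (fun n => μ.real (towerUnion T p B n ∩ F)) atTop (𝓝 (μ.real F)) := by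
    intro F
    have h1 : Tendsto (fun n => μ (towerUnion T p B n ∩ F)) atTop
        (𝓝 (μ (⋃ n, towerUnion T p B n ∩ F))) :=
      tendsto_measure_iUnion_atTop fun m n hmn => inter_subset_inter_left _ (h.towerUnion_mono hmn)
    have h2 : μ (⋃ n, towerUnion T p B n ∩ F) = μ F := by
      rw [← iUnion_inter]
      refine measure_congr ?_
      filter_upwards [h.ae_mem_iUnion_towerUnion hgen] with x hx
      exact propext ⟨fun h => h.2, fun h => ⟨hx, h⟩⟩
    rw [h2] at h1
    exact (ENNReal.tendsto_toReal (measure_ne_top μ F)).comp h1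
  have htower : ∀ n, μ.real (towerUnion T p B n ∩ E) * μ.real (B 0) =
      μ.real (B 0 ∩ E) * μ.real (towerUnion T p B n ∩ univ) := by
    intro n
    rw [h.measureReal_towerUnion_inter hT hE hinv,
      h.measureReal_towerUnion_inter hT .univ preimage_univ, inter_univ, mul_assoc, hbase]
    ring
  have hE0 : μ.real E * μ.real (B 0) = μ.real (B 0 ∩ E) := by
    have h1 := (hYlim E).mul_const (μ.real (B 0))
    simp only [htower] at h1
    have h2 := (hYlim univ).const_mul (μ.real (B 0 ∩ E))
    rw [probReal_univ, mul_one] at h2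
    exact tendsto_nhds_unique h1 h2
  have hB0 : 0 < μ.real (B 0) := by
    refine lt_of_le_of_ne measureReal_nonneg fun h0 => ?_
    have hzero : ∀ n, μ.real (B n) = 0 := by
      intro n
      induction n with
      | zero => exact h0.symm
      | succ n ih =>
        rw [h.measureReal_base hT n] at ih
        exact (mul_eq_zero.1 ih).resolve_left (by have := (p n).two_le_q; positivity)
    have h1 := hYlim univ
    have h2 : ∀ n, μ.real (towerUnion T p B n ∩ univ) = 0 := fun n => by
      rw [h.measureReal_towerUnion_inter hT .univ preimage_univ, inter_univ, hzero, mul_zero]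
    simp only [h2, probReal_univ] at h1
    exact zero_ne_one (tendsto_nhds_unique tendsto_const_nhds h1)
  have hind : ∀ A, MeasurableSet A → μ.real (A ∩ E) = μ.real E * μ.real A := by
    intro A hA
    refine h.induction_on_levels hgen (P := fun A => μ.real (A ∩ E) = μ.real E * μ.real A)
      ?_ ?_ ?_ ?_ ?_ hA
    · simp
    · intro n k hk
      rw [measureReal_image_iterate_inter hT k (h.meas_base n) hE hinv,
        measureReal_image_iterate hT k (h.meas_base n)]
      refine mul_right_cancel₀ hB0.ne' ?_
      rw [hbase, ← hE0]
      ring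
    · intro A hA ih
      have h1 := measureReal_inter_add_sdiff (μ := μ) (s := E) hA
      rw [inter_comm, ih, sdiff_eq, inter_comm E] at h1
      rw [measureReal_compl hA, probReal_univ]
      linarith
    · intro f hd hf ih
      have h1 : HasSum (fun i => μ.real (f i ∩ E)) (μ.real ((⋃ i, f i) ∩ E)) := by
        rw [iUnion_inter]
        exact hasSum_measureReal_iUnion (fun i => (hf i).inter hE)
          fun i j hij => (hd hij).mono inter_subset_left inter_subset_left
      have h2 : HasSum (fun i => μ.real (f i)) (μ.real (⋃ i, f i)) :=
        hasSum_measureReal_iUnion hf hd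
      simp only [ih] at h1
      exact h1.unique (h2.mul_left _)
    · intro A A' hAA' ih
      rw [measureReal_congr (hAA'.inter (ae_eq_refl E)), measureReal_congr hAA', ih]
  have h1 := hind E hE
  rw [inter_self] at h1
  rw [eventuallyConst_set']
  rcases eq_or_ne (μ.real E) 0 with h0 | h0
  · left
    rwa [ae_eq_empty, ← measureReal_eq_zero_iff]
  · right
    have h2 : μ.real E = 1 := by
      refine mul_left_cancel₀ h0 ?_
      linarith
    rw [ae_eq_univ, ← measureReal_eq_zero_iff, measureReal_compl hE, probReal_univ, h2, sub_self]

end IsCuttingStacking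

namespace IsCuttingStacking
variable {X : Type} [MeasurableSpace X] {μ : Measure X} [IsProbabilityMeasure μ] {T : X ≃ᵐ X}
  {p : ℕ → CSParam} {B : ℕ → Set X} {Bsub : ℕ → ℕ → Set X}

omit [IsProbabilityMeasure μ] in
lemma disjoint_image_sub (h : IsCuttingStacking T p B Bsub) {n : ℕ} {s t : ℕ × ℕ} (hst : s ≠ t)
    (hs : s.1 < heights p n) (hs' : s.2 < (p n).q) (ht : t.1 < heights p n) (ht' : t.2 < (p n).q) :
    Disjoint ((⇑T)^[s.1] '' Bsub n s.2) ((⇑T)^[t.1] '' Bsub n t.2) := by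
  by_cases h1 : s.1 = t.1
  · rw [h1, disjoint_image_iff (T.injective.iterate _)]
    exact h.disj_sub n _ hs' _ ht' fun h2 => hst (Prod.ext h1 h2)
  · exact (h.disj_levels n _ hs _ ht h1).mono (image_mono (h.sub_subset hs'))
      (image_mono (h.sub_subset ht'))

lemma measureReal_image_sub (h : IsCuttingStacking T p B Bsub) (hT : MeasurePreserving T μ μ)
    {n i : ℕ} (hi : i < (p n).q) (z : ℕ) :
    μ.real ((⇑T)^[z] '' Bsub n i) = μ.real (B n) / (p n).q := by
  have hq : ((p n).q : ℝ) ≠ 0 := by have := (p n).two_le_q; positivity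
  rw [measureReal_image_iterate hT z (h.meas_sub n i hi), h.sub_eq hi,
    measureReal_image_iterate hT _ (h.meas_base _), h.measureReal_base hT n]
  field_simp

/-- `C` is compatible with the `n`-th tower: each level is contained in `C` or disjoint from it. -/
def Adapted (T : X ≃ᵐ X) (p : ℕ → CSParam) (B : ℕ → Set X) (n : ℕ) (C : Set X) : Prop :=
  ∀ z < heights p n, (⇑T)^[z] '' B n ⊆ C ∨ Disjoint ((⇑T)^[z] '' B n) C

lemma measureReal_image_sub_inter (h : IsCuttingStacking T p B Bsub)
    (hT : MeasurePreserving T μ μ) {n i z : ℕ} (hi : i < (p n).q) (hz : z < heights p n)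
    {C : Set X} (hC : Adapted T p B n C) :
    μ.real ((⇑T)^[z] '' Bsub n i ∩ C) = μ.real ((⇑T)^[z] '' B n ∩ C) / (p n).q := by
  have hsub : (⇑T)^[z] '' Bsub n i ⊆ (⇑T)^[z] '' B n := image_mono (h.sub_subset hi)
  rcases hC z hz with hc | hc
  · rw [inter_eq_self_of_subset_left hc, inter_eq_self_of_subset_left (hsub.trans hc),
      h.measureReal_image_sub hT hi, measureReal_image_iterate hT z (h.meas_base n)]
  · rw [hc.inter_eq, (hc.mono_left hsub).inter_eq, measureReal_empty, zero_div]

end IsCuttingStacking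

lemma measureReal_inter_preimage_iterate {X : Type} [MeasurableSpace X] {μ : Measure X}
    {T : X ≃ᵐ X} (hT : MeasurePreserving T μ μ) (k : ℕ) {S C : Set X} (hS : MeasurableSet S)
    (hC : MeasurableSet C) :
    μ.real (S ∩ (⇑T)^[k] ⁻¹' C) = μ.real ((⇑T)^[k] '' S ∩ C) := by
  rw [← image_inter_preimage,
    measureReal_image_iterate hT k (hS.inter ((hT.iterate k).measurable hC))]

lemma colStart_eq {p : ℕ → CSParam} {n : ℕ} {a : ℕ → ℕ} (ha : IsOrnsteinStep n (p n) a) {i : ℕ}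
    (hi : i < (p n).q) : colStart p n i = i * (heights p n + (n + 1)) + a i := by
  rw [colStart, ha.sum_spacers i hi]
  ring

lemma heights_succ_eq {p : ℕ → CSParam} {n : ℕ} {a : ℕ → ℕ} (ha : IsOrnsteinStep n (p n) a) :
    heights p (n + 1) = (p n).q * (heights p n + (n + 1)) := by
  rw [heights, ha.σtot_eq, ← mul_add]

/-- Averages over pairs of letters at a fixed distance in a word with small pair correlations. -/
lemma IsOrnsteinStep.abs_sum_sub_le {m : ℕ} {P : CSParam} {a : ℕ → ℕ} (h : IsOrnsteinStep m P a)
    {G : ℕ → ℕ → ℝ} (hG : ∀ u v, |G u v| ≤ 1) {j : ℕ} (hj : 1 ≤ j) (hjq : j < P.q) :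
    |∑ i ∈ Finset.range (P.q - j), (G (a i) (a (i + j))
      - ((m + 1 : ℕ) : ℝ)⁻¹ * ∑ v ∈ Finset.range (m + 1), G (a i) v)|
      ≤ P.q / ((m + 1 : ℕ) : ℝ) := by
  have hexp : ∀ i, G (a i) (a (i + j))
      - ((m + 1 : ℕ) : ℝ)⁻¹ * ∑ v ∈ Finset.range (m + 1), G (a i) v =
      ∑ u ∈ Finset.range (m + 1), ∑ v ∈ Finset.range (m + 1),
        G u v * pairTest (m + 1) a j u v i := by
    intro i
    refine Eq.trans ?_ (Finset.sum_eq_single_of_mem (a i) (Finset.mem_range.2 (h.lt i))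
      fun u _ hu => Finset.sum_eq_zero fun v _ => by rw [pairTest, if_neg hu.symm, mul_zero]).symm
    simp only [pairTest, if_true, mul_sub, mul_ite, mul_one, mul_zero, Finset.sum_sub_distrib]
    rw [Finset.sum_ite_eq, if_pos (Finset.mem_range.2 (h.lt _)), Finset.mul_sum]
    congr 1
    exact Finset.sum_congr rfl fun v _ => by rw [one_div, mul_comm]
  have hm : (0 : ℝ) < ((m + 1 : ℕ) : ℝ) := by positivity
  calc _ = |∑ u ∈ Finset.range (m + 1), ∑ v ∈ Finset.range (m + 1),
        G u v * ∑ i ∈ Finset.range (P.q - j), pairTest (m + 1) a j u v i| := by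
        congr 1
        rw [Finset.sum_congr rfl fun i _ => hexp i, Finset.sum_comm]
        refine Finset.sum_congr rfl fun u _ => ?_
        rw [Finset.sum_comm]
        exact Finset.sum_congr rfl fun v _ => (Finset.mul_sum _ _ _).symm
    _ ≤ ∑ u ∈ Finset.range (m + 1), ∑ v ∈ Finset.range (m + 1),
        1 / ((m + 1 : ℕ) : ℝ) ^ 3 * P.q := by
        refine (Finset.abs_sum_le_sum_abs _ _).trans (Finset.sum_le_sum fun u hu => ?_)
        refine (Finset.abs_sum_le_sum_abs _ _).trans (Finset.sum_le_sum fun v hv => ?_)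
        rw [abs_mul, ← one_mul (1 / ((m + 1 : ℕ) : ℝ) ^ 3 * P.q)]
        exact mul_le_mul (hG u v) (h.pair_bound j hj hjq u (Finset.mem_range.1 hu) v
          (Finset.mem_range.1 hv)) (abs_nonneg _) zero_le_one
    _ = P.q / ((m + 1 : ℕ) : ℝ) := by
        simp only [Finset.sum_const, Finset.card_range, nsmul_eq_mul]
        field_simp

lemma abs_sum_measureReal_sub_le {X : Type} [MeasurableSpace X] {μ : Measure X}
    [IsProbabilityMeasure μ] {T : X → X} (hT : MeasurePreserving T μ μ) (S : Set X)
    {C : Set X} (hC : MeasurableSet C) (w : ℕ) :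
    |(w : ℝ)⁻¹ * ∑ v ∈ Finset.range w, μ.real (S ∩ T^[v] ⁻¹' C) - μ.real S * μ.real C|
      ≤ cesaroDeviation μ T C w := by
  have hm : ∀ v, MeasurableSet (T^[v] ⁻¹' C) := fun v => (hT.iterate v).measurable hC
  have hint : ∀ v, Integrable (fun x => C.indicator (1 : X → ℝ) (T^[v] x)) μ := fun v =>
    (integrable_const (1 : ℝ)).indicator (hm v)
  have hF : Integrable (fun x => (w : ℝ)⁻¹ * ∑ v ∈ Finset.range w, C.indicator (1 : X → ℝ) (T^[v] x)
      - μ.real C) μ :=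
    ((integrable_finsetSum _ fun v _ => hint v).const_mul _).sub (integrable_const _)
  have hval : ∀ v, ∫ x in S, C.indicator (1 : X → ℝ) (T^[v] x) ∂μ = μ.real (S ∩ T^[v] ⁻¹' C) := by
    intro v
    have h1 : (fun x => C.indicator (1 : X → ℝ) (T^[v] x)) = (T^[v] ⁻¹' C).indicator 1 := rfl
    rw [h1, integral_indicator_one (hm v), measureReal_restrict_apply (hm v), inter_comm]
  have heq : (w : ℝ)⁻¹ * ∑ v ∈ Finset.range w, μ.real (S ∩ T^[v] ⁻¹' C) - μ.real S * μ.real C =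
      ∫ x in S, ((w : ℝ)⁻¹ * ∑ v ∈ Finset.range w, C.indicator (1 : X → ℝ) (T^[v] x)
        - μ.real C) ∂μ := by
    rw [integral_sub ((integrable_finsetSum _ fun v _ => (hint v).integrableOn).const_mul _)
      (integrable_const _), integral_const_mul,
      integral_finsetSum _ fun v _ => (hint v).integrableOn]
    simp [hval]
  rw [heq]
  exact abs_integral_le_integral_abs.trans
    (setIntegral_le_integral hF.abs (Eventually.of_forall fun x => abs_nonneg _))

/-- The union of the portions of the levels `z ∈ Z` of the `n`-th tower lying in its first `r`
subcolumns. -/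
def copies {X : Type} (T : X → X) (Bsub : ℕ → ℕ → Set X) (n : ℕ) (Z : Finset ℕ) (r : ℕ) : Set X :=
  ⋃ t ∈ Z ×ˢ Finset.range r, T^[t.1] '' Bsub n t.2

namespace IsCuttingStacking
variable {X : Type} [MeasurableSpace X] {μ : Measure X} [IsProbabilityMeasure μ] {T : X ≃ᵐ X}
  {p : ℕ → CSParam} {B : ℕ → Set X} {Bsub : ℕ → ℕ → Set X}

lemma measureReal_copies_inter (h : IsCuttingStacking T p B Bsub) {n r : ℕ} (hr : r ≤ (p n).q)
    {Z : Finset ℕ} (hZ : ∀ z ∈ Z, z < heights p n) {D : Set X} (hD : MeasurableSet D) :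
    μ.real (copies T Bsub n Z r ∩ D) =
      ∑ i ∈ Finset.range r, ∑ z ∈ Z, μ.real ((⇑T)^[z] '' Bsub n i ∩ D) := by
  rw [copies, iUnion₂_inter, measureReal_biUnion_finset, Finset.sum_product_right]
  · intro s hs t ht hst
    simp only [Finset.coe_product, mem_prod, Finset.mem_coe, Finset.mem_range] at hs ht
    exact (h.disjoint_image_sub hst (hZ _ hs.1) (by omega) (hZ _ ht.1) (by omega)).mono
      inter_subset_left inter_subset_left
  · intro t ht
    simp only [Finset.mem_product, Finset.mem_range] at ht
    exact (measurableSet_image_iterate _ (h.meas_sub n _ (by omega))).inter hD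

lemma measureReal_copies (h : IsCuttingStacking T p B Bsub) (hT : MeasurePreserving T μ μ)
    {n r : ℕ} (hr : r ≤ (p n).q) {Z : Finset ℕ} (hZ : ∀ z ∈ Z, z < heights p n) :
    μ.real (copies T Bsub n Z r) = r * (Z.card * μ.real (B n)) / (p n).q := by
  have h1 := h.measureReal_copies_inter (μ := μ) hr hZ MeasurableSet.univ
  simp only [inter_univ] at h1
  rw [h1, Finset.sum_congr rfl fun i hi => Finset.sum_congr rfl fun z _ =>
    h.measureReal_image_sub hT ((Finset.mem_range.1 hi).trans_le hr) z]
  simp only [Finset.sum_const, Finset.card_range, nsmul_eq_mul]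
  ring

/-- Most of the subcolumns of the `n`-th tower return after time `k` to the `j`-th next subcolumn,
with an offset that is averaged by the spacers. -/
lemma abs_measureReal_copies_sub_le (h : IsCuttingStacking T p B Bsub)
    (hT : MeasurePreserving T μ μ) {n : ℕ} {a : ℕ → ℕ} (ha : IsOrnsteinStep n (p n) a) {j k : ℕ}
    (hj : 1 ≤ j) {Z : Finset ℕ} (hZ : ∀ z ∈ Z, z < heights p n ∧
      j * (heights p n + (n + 1)) + (n + 1) ≤ z + k ∧
      z + k + (n + 1) ≤ j * (heights p n + (n + 1)) + heights p n)
    {C : Set X} (hC : MeasurableSet C) (hCn : Adapted T p B n C) :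
    |μ.real (copies T Bsub n Z ((p n).q - j) ∩ (⇑T)^[k] ⁻¹' C)
      - μ.real (copies T Bsub n Z ((p n).q - j)) * μ.real C|
      ≤ 1 / ((n + 1 : ℕ) : ℝ) + cesaroDeviation μ T C (n + 1) := by
  have hdev : 0 ≤ cesaroDeviation μ T C (n + 1) := integral_nonneg fun x => abs_nonneg _
  by_cases hjq : j < (p n).q
  swap
  · rw [Nat.sub_eq_zero_of_le (not_lt.1 hjq), copies]
    simp only [Finset.range_zero, Finset.product_empty, Finset.notMem_empty, iUnion_of_empty,
      iUnion_empty, empty_inter, measureReal_empty, zero_mul, sub_zero, abs_zero]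
    positivity
  have hq : (0 : ℝ) < (p n).q := by have := (p n).two_le_q; positivity
  have hCk : MeasurableSet ((⇑T)^[k] ⁻¹' C) := (hT.iterate k).measurable hC
  set H := heights p n
  set J := j * (H + (n + 1)) with hJ
  let s : ℕ → ℕ := fun z => z + k - (J + n)
  have hs : ∀ z ∈ Z, s z + (J + n) = z + k := fun z hz => by
    have := hZ z hz; exact Nat.sub_add_cancel (by omega)
  have hdisj : ∀ m, ∀ z ∈ Z, ∀ z' ∈ Z, z ≠ z' →
      Disjoint ((⇑T)^[m + s z] '' B n) ((⇑T)^[m + s z'] '' B n) := by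
    intro m z hz z' hz' hzz'
    rw [disjoint_image_iterate_add]
    have h1 := hs z hz
    have h2 := hs z' hz'
    have h3 := hZ z hz
    have h4 := hZ z' hz'
    exact h.disj_levels n _ (by omega) _ (by omega) (by omega)
  let G : ℕ → ℕ → ℝ := fun u v => ∑ z ∈ Z, μ.real ((⇑T)^[u + (n - v) + s z] '' B n ∩ C)
  have hG : ∀ u v, |G u v| ≤ 1 := by
    intro u v
    rw [abs_of_nonneg (Finset.sum_nonneg fun _ _ => measureReal_nonneg),
      ← measureReal_biUnion_finset]
    · exact measureReal_le_one
    · intro z hz z' hz' hzz'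
      exact (hdisj _ z hz z' hz' hzz').mono inter_subset_left inter_subset_left
    · exact fun z _ => (h.measurableSet_level n _).inter hC
  have hcorr : (p n).q * μ.real (copies T Bsub n Z ((p n).q - j) ∩ (⇑T)^[k] ⁻¹' C) =
      ∑ i ∈ Finset.range ((p n).q - j), G (a i) (a (i + j)) := by
    rw [h.measureReal_copies_inter (Nat.sub_le _ _) (fun z hz => (hZ z hz).1) hCk, Finset.mul_sum]
    refine Finset.sum_congr rfl fun i hi => ?_
    rw [Finset.mul_sum]
    refine Finset.sum_congr rfl fun z hz => ?_
    rw [Finset.mem_range] at hi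
    have h1 := hs z hz
    have h2 := hZ z hz
    have h3 := ha.lt i
    have h4 := ha.lt (i + j)
    have hi1 : i < (p n).q := by omega
    have hij : i + j < (p n).q := by omega
    have himage : (⇑T)^[k] '' ((⇑T)^[z] '' Bsub n i) =
        (⇑T)^[a i + (n - a (i + j)) + s z] '' Bsub n (i + j) := by
      rw [h.sub_eq hi1, h.sub_eq hij, ← image_iterate_add, ← image_iterate_add,
        ← image_iterate_add, colStart_eq ha hi1, colStart_eq ha hij, add_mul i j, ← hJ]
      congr 2
      omega
    rw [measureReal_inter_preimage_iterate hT k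
      (measurableSet_image_iterate z (h.meas_sub n i hi1)) hC, himage,
      h.measureReal_image_sub_inter hT hij (by omega) hCn]
    field_simp
  have hmean : ∀ u, |((n + 1 : ℕ) : ℝ)⁻¹ * ∑ v ∈ Finset.range (n + 1), G u v
      - Z.card * μ.real (B n) * μ.real C| ≤ cesaroDeviation μ T C (n + 1) := by
    intro u
    have hpd : (Z : Set ℕ).PairwiseDisjoint fun z => (⇑T)^[u + s z] '' B n :=
      fun z hz z' hz' hzz' => hdisj u z hz z' hz' hzz'
    have h1 : μ.real (⋃ z ∈ Z, (⇑T)^[u + s z] '' B n) = Z.card * μ.real (B n) := by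
      rw [measureReal_biUnion_finset hpd fun z _ => h.measurableSet_level n _,
        Finset.sum_congr rfl fun z _ => measureReal_image_iterate hT _ (h.meas_base n)]
      simp
    have h2 : ∑ v ∈ Finset.range (n + 1), G u v = ∑ v ∈ Finset.range (n + 1),
        μ.real ((⋃ z ∈ Z, (⇑T)^[u + s z] '' B n) ∩ (⇑T)^[v] ⁻¹' C) := by
      rw [← Finset.sum_range_reflect]
      refine Finset.sum_congr rfl fun v hv => ?_
      rw [Finset.mem_range] at hv
      rw [iUnion₂_inter, measureReal_biUnion_finset]
      · refine Finset.sum_congr rfl fun z _ => ?_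
        rw [measureReal_inter_preimage_iterate hT v (h.measurableSet_level n _) hC,
          ← image_iterate_add]
        congr 4
        omega
      · exact fun z hz z' hz' hzz' => (hdisj u z hz z' hz' hzz').mono
          inter_subset_left inter_subset_left
      · exact fun z _ => (h.measurableSet_level n _).inter ((hT.iterate v).measurable hC)
    rw [h2, ← h1]
    exact abs_sum_measureReal_sub_le hT _ hC (n + 1)
  have hmeas : (p n).q * μ.real (copies T Bsub n Z ((p n).q - j)) =
      ∑ _i ∈ Finset.range ((p n).q - j), Z.card * μ.real (B n) := by
    rw [h.measureReal_copies hT (Nat.sub_le _ _) (fun z hz => (hZ z hz).1)]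
    simp only [Finset.sum_const, Finset.card_range, nsmul_eq_mul]
    field_simp
  refine le_of_mul_le_mul_left ?_ hq
  rw [← abs_of_pos hq, ← abs_mul, abs_of_pos hq, mul_sub, ← mul_assoc, hcorr, hmeas,
    Finset.sum_mul, ← Finset.sum_sub_distrib]
  calc _ = |∑ i ∈ Finset.range ((p n).q - j), (G (a i) (a (i + j))
        - ((n + 1 : ℕ) : ℝ)⁻¹ * ∑ v ∈ Finset.range (n + 1), G (a i) v)
        + ∑ i ∈ Finset.range ((p n).q - j), (((n + 1 : ℕ) : ℝ)⁻¹ *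
          ∑ v ∈ Finset.range (n + 1), G (a i) v - Z.card * μ.real (B n) * μ.real C)| := by
        rw [← Finset.sum_add_distrib]
        congr 1
        exact Finset.sum_congr rfl fun i _ => by ring
    _ ≤ (p n).q / ((n + 1 : ℕ) : ℝ) +
        ∑ _i ∈ Finset.range ((p n).q - j), cesaroDeviation μ T C (n + 1) :=
        (abs_add_le _ _).trans (add_le_add (ha.abs_sum_sub_le hG hj hjq)
          ((Finset.abs_sum_le_sum_abs _ _).trans (Finset.sum_le_sum fun i _ => hmean (a i))))
    _ ≤ (p n).q * (1 / ((n + 1 : ℕ) : ℝ) + cesaroDeviation μ T C (n + 1)) := by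
        rw [Finset.sum_const, Finset.card_range, nsmul_eq_mul, mul_add, mul_one_div]
        gcongr
        exact Nat.sub_le _ _

end IsCuttingStacking

namespace IsCuttingStacking
variable {X : Type} [MeasurableSpace X] {μ : Measure X} [IsProbabilityMeasure μ] {T : X ≃ᵐ X}
  {p : ℕ → CSParam} {B : ℕ → Set X} {Bsub : ℕ → ℕ → Set X}

omit [IsProbabilityMeasure μ] in
lemma measurableSet_copies (h : IsCuttingStacking T p B Bsub) {n r : ℕ} (hr : r ≤ (p n).q)
    (Z : Finset ℕ) : MeasurableSet (copies T Bsub n Z r) := by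
  refine Finset.measurableSet_biUnion _ fun t ht => ?_
  simp only [Finset.mem_product, Finset.mem_range] at ht
  exact measurableSet_image_iterate _ (h.meas_sub n _ (by omega))

omit [IsProbabilityMeasure μ] in
lemma copies_subset (h : IsCuttingStacking T p B Bsub) {n r : ℕ} (hr : r ≤ (p n).q)
    {Z : Finset ℕ} {A : Set X} (hZ : ∀ z ∈ Z, (⇑T)^[z] '' B n ⊆ A) :
    copies T Bsub n Z r ⊆ A := by
  refine iUnion₂_subset fun t ht => ?_
  simp only [Finset.mem_product, Finset.mem_range] at ht
  exact (image_mono (h.sub_subset (by omega))).trans (hZ _ ht.1)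

omit [IsProbabilityMeasure μ] in
lemma disjoint_copies (h : IsCuttingStacking T p B Bsub) {n r r' : ℕ} (hr : r ≤ (p n).q)
    (hr' : r' ≤ (p n).q) {Z Z' : Finset ℕ} (hZ : ∀ z ∈ Z, z < heights p n)
    (hZ' : ∀ z ∈ Z', z < heights p n) (hd : Disjoint Z Z') :
    Disjoint (copies T Bsub n Z r) (copies T Bsub n Z' r') := by
  simp only [copies, disjoint_iUnion₂_left, disjoint_iUnion₂_right]
  intro t ht s hs
  simp only [Finset.mem_product, Finset.mem_range] at hs ht
  refine h.disjoint_image_sub (fun hst => ?_) (hZ _ hs.1) (by omega) (hZ' _ ht.1) (by omega)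
  exact Finset.disjoint_left.1 hd hs.1 (hst ▸ ht.1)

omit [IsProbabilityMeasure μ] in
lemma disjoint_copies_succ (h : IsCuttingStacking T p B Bsub) {n r r' : ℕ} (hr : r ≤ (p n).q)
    (hr' : r' ≤ (p (n + 1)).q) {Z Y : Finset ℕ} (hZ : ∀ z ∈ Z, z < heights p n)
    (hY : ∀ y ∈ Y, y < heights p (n + 1)) (hd : ∀ z ∈ Z, ∀ i < r, colStart p n i + z ∉ Y) :
    Disjoint (copies T Bsub n Z r) (copies T Bsub (n + 1) Y r') := by
  simp only [copies, disjoint_iUnion₂_left, disjoint_iUnion₂_right]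
  intro t ht s hs
  simp only [Finset.mem_product, Finset.mem_range] at hs ht
  have hs2 : s.2 < (p n).q := by omega
  rw [← h.subcolumn n _ hs2 _ (hZ _ hs.1)]
  refine (h.disj_levels (n + 1) _ (colStart_add_lt_heights p hs2 (hZ _ hs.1)) _ (hY _ ht.1)
    fun he => ?_).mono_right (image_mono (h.sub_subset (by omega)))
  exact hd _ hs.1 _ hs.2 (he ▸ ht.1)

lemma measureReal_biUnion_level_le (h : IsCuttingStacking T p B Bsub)
    (hT : MeasurePreserving T μ μ) (n : ℕ) {W : Finset ℕ} {c : ℕ} (hW : W.card ≤ c) :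
    μ.real (⋃ z ∈ W, (⇑T)^[z] '' B n) ≤ c / (heights p n : ℝ) := by
  have hh : (0 : ℝ) < heights p n := by exact_mod_cast heights_pos p n
  calc _ ≤ ∑ z ∈ W, μ.real ((⇑T)^[z] '' B n) := measureReal_biUnion_finset_le _ _
    _ = W.card * μ.real (B n) := by
      rw [Finset.sum_congr rfl fun z _ => measureReal_image_iterate hT z (h.meas_base n)]
      simp
    _ ≤ c * (1 / (heights p n : ℝ)) := by
      gcongr
      rw [le_div_iff₀ hh, mul_comm]
      exact h.heights_mul_measureReal_base_le hT n
    _ = c / (heights p n : ℝ) := mul_one_div _ _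

lemma measureReal_biUnion_sub_le (h : IsCuttingStacking T p B Bsub)
    (hT : MeasurePreserving T μ μ) {n i : ℕ} (hi : i < (p n).q) :
    μ.real (⋃ z ∈ Finset.range (heights p n), (⇑T)^[z] '' Bsub n i) ≤ 1 / ((p n).q : ℝ) := by
  calc _ ≤ ∑ z ∈ Finset.range (heights p n), μ.real ((⇑T)^[z] '' Bsub n i) :=
        measureReal_biUnion_finset_le _ _
    _ = heights p n * μ.real (B n) / (p n).q := by
      rw [Finset.sum_congr rfl fun z _ => h.measureReal_image_sub hT hi z]
      simp [mul_div_assoc]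
    _ ≤ 1 / ((p n).q : ℝ) := by
      gcongr
      exact h.heights_mul_measureReal_base_le hT n

/-- The bound on correlations of unions of levels for times between `h_n` and `h_{n+1}`. -/
noncomputable def mixingBound (μ : Measure X) (T : X → X) (p : ℕ → CSParam) (C : Set X) (n : ℕ) :
    ℝ :=
  2 * (1 / ((n + 1 : ℕ) : ℝ) + cesaroDeviation μ T C (n + 1))
    + (1 / ((n + 1 + 1 : ℕ) : ℝ) + cesaroDeviation μ T C (n + 1 + 1))
    + ((5 * (n + 1) : ℕ) / (heights p n : ℝ) + (2 * (n + 2) : ℕ) / (heights p (n + 1) : ℝ)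
      + 1 / ((p (n + 1)).q : ℝ))

lemma abs_measureReal_inter_sub_le (h : IsCuttingStacking T p B Bsub)
    (hT : MeasurePreserving T μ μ) {n k : ℕ} {a a' : ℕ → ℕ} (ha : IsOrnsteinStep n (p n) a)
    (ha' : IsOrnsteinStep (n + 1) (p (n + 1)) a') (hnk : heights p n ≤ k)
    (hkn : k < heights p (n + 1)) {A C : Set X} (hA : MeasurableSet A)
    (hAn : Adapted T p B n A) (hAX : A ⊆ towerUnion T p B n) (hC : MeasurableSet C)
    (hCn : Adapted T p B n C) (hCn' : Adapted T p B (n + 1) C) :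
    |μ.real (A ∩ (⇑T)^[k] ⁻¹' C) - μ.real A * μ.real C| ≤ mixingBound μ T p C n := by
  classical
  set H := heights p n with hH
  set H' := heights p (n + 1) with hH'
  have hHH' : H' = (p n).q * (H + (n + 1)) := heights_succ_eq ha
  have hq := (p n).two_le_q
  have hq' := (p (n + 1)).two_le_q
  obtain ⟨j, ρ, hkj, hρlt⟩ : ∃ j ρ, j * (H + (n + 1)) + ρ = k ∧ ρ < H + (n + 1) :=
    ⟨k / (H + (n + 1)), k % (H + (n + 1)), Nat.div_add_mod' k _, Nat.mod_lt _ (by omega)⟩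
  let Z₁ := (Finset.range H).filter fun z => (⇑T)^[z] '' B n ⊆ A ∧
    n + 1 ≤ z + ρ ∧ z + ρ + (n + 1) < H
  let Z₂ := (Finset.range H).filter fun z => (⇑T)^[z] '' B n ⊆ A ∧
    H + 2 * (n + 1) ≤ z + ρ ∧ z + ρ < 2 * H
  let Y := (Finset.range H').filter fun y => (⇑T)^[y] '' B (n + 1) ⊆ A ∧
    H' + 2 * (n + 2) ≤ y + k ∧ y + k < 2 * H'
  let W := (Finset.range H).filter fun z => z + ρ < n + 1 ∨
    (H ≤ z + ρ + (n + 1) ∧ z + ρ < H + 2 * (n + 1)) ∨ 2 * H ≤ z + ρ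
  let W' := (Finset.range H').filter fun y => H' ≤ y + k ∧ y + k < H' + 2 * (n + 2)
  have hZ₁ : ∀ z ∈ Z₁, z < H ∧ (⇑T)^[z] '' B n ⊆ A ∧ n + 1 ≤ z + ρ ∧ z + ρ + (n + 1) < H := by
    simp [Z₁]
  have hZ₂ : ∀ z ∈ Z₂, z < H ∧ (⇑T)^[z] '' B n ⊆ A ∧ H + 2 * (n + 1) ≤ z + ρ ∧ z + ρ < 2 * H := by
    simp [Z₂]
  have hY : ∀ y ∈ Y, y < H' ∧ (⇑T)^[y] '' B (n + 1) ⊆ A ∧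
      H' + 2 * (n + 2) ≤ y + k ∧ y + k < 2 * H' := by
    simp [Y]
  have hWcard : W.card ≤ 5 * (n + 1) := by
    calc W.card ≤ (Finset.range (n + 1) ∪ (Finset.Ico (H - (n + 1)) (H + 2 * (n + 1)) ∪
          Finset.Ico (2 * H) (2 * H + (n + 1)))).card := by
          refine Finset.card_le_card_of_injOn (fun z => z + ρ) ?_ fun x _ y _ hxy => by
            simpa using hxy
          intro z hz
          simp only [W, Finset.coe_filter, Finset.mem_range, mem_ofPred_eq] at hz
          simp only [Finset.coe_union, Finset.coe_range, Finset.coe_Ico, mem_union, mem_Iio,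
            mem_Ico]
          omega
      _ ≤ 5 * (n + 1) := by
          refine (Finset.card_union_le _ _).trans ?_
          have := Finset.card_union_le (Finset.Ico (H - (n + 1)) (H + 2 * (n + 1)))
            (Finset.Ico (2 * H) (2 * H + (n + 1)))
          simp only [Finset.card_range, Nat.card_Ico] at this ⊢
          omega
  have hWcard' : W'.card ≤ 2 * (n + 2) := by
    calc W'.card ≤ (Finset.Ico H' (H' + 2 * (n + 2))).card := by
          refine Finset.card_le_card_of_injOn (fun z => z + k) ?_ fun x _ y _ hxy => by
            simpa using hxy
          intro z hz
          simp only [W', Finset.coe_filter, Finset.mem_range, mem_ofPred_eq] at hz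
          simpa using hz.2
      _ = 2 * (n + 2) := by simp
  set P₁ := copies T Bsub n Z₁ ((p n).q - j)
  set P₂ := copies T Bsub n Z₂ ((p n).q - (j + 1))
  set P₃ := copies T Bsub (n + 1) Y ((p (n + 1)).q - 1)
  have hP₁m : MeasurableSet P₁ := h.measurableSet_copies (Nat.sub_le _ _) _
  have hP₂m : MeasurableSet P₂ := h.measurableSet_copies (Nat.sub_le _ _) _
  have hP₃m : MeasurableSet P₃ := h.measurableSet_copies (Nat.sub_le _ _) _
  have hd₁₂ : Disjoint P₁ P₂ := by
    refine h.disjoint_copies (Nat.sub_le _ _) (Nat.sub_le _ _) (fun z hz => (hZ₁ z hz).1)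
      (fun z hz => (hZ₂ z hz).1) (Finset.disjoint_left.2 fun z hz hz' => ?_)
    have := hZ₁ z hz
    have := hZ₂ z hz'
    omega
  have hcol : ∀ i < (p n).q, colStart p n i + k = (i + j) * (H + (n + 1)) + a i + ρ := by
    intro i hi
    rw [colStart_eq ha hi, ← hkj]
    ring
  have hd₁₃ : Disjoint P₁ P₃ := by
    refine h.disjoint_copies_succ (Nat.sub_le _ _) (Nat.sub_le _ _) (fun z hz => (hZ₁ z hz).1)
      (fun z hz => (hY z hz).1) fun z hz i hi hmem => ?_
    have h1 := hZ₁ z hz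
    have h2 := hY _ hmem
    have h3 := hcol i (by omega)
    have h4 := ha.lt i
    have h5 : (i + j + 1) * (H + (n + 1)) ≤ (p n).q * (H + (n + 1)) :=
      Nat.mul_le_mul_right _ (by omega)
    rw [← hHH', add_mul] at h5
    omega
  have hd₂₃ : Disjoint P₂ P₃ := by
    refine h.disjoint_copies_succ (Nat.sub_le _ _) (Nat.sub_le _ _) (fun z hz => (hZ₂ z hz).1)
      (fun z hz => (hY z hz).1) fun z hz i hi hmem => ?_
    have h1 := hZ₂ z hz
    have h2 := hY _ hmem
    have h3 := hcol i (by omega)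
    have h4 := ha.lt i
    have h5 : (i + j + 1 + 1) * (H + (n + 1)) ≤ (p n).q * (H + (n + 1)) :=
      Nat.mul_le_mul_right _ (by omega)
    rw [← hHH', add_mul, add_mul] at h5
    omega
  have hPA : P₁ ∪ P₂ ∪ P₃ ⊆ A :=
    union_subset (union_subset
      (h.copies_subset (Nat.sub_le _ _) fun z hz => (hZ₁ z hz).2.1)
      (h.copies_subset (Nat.sub_le _ _) fun z hz => (hZ₂ z hz).2.1))
      (h.copies_subset (Nat.sub_le _ _) fun z hz => (hY z hz).2.1)
  have hcover : A \ (P₁ ∪ P₂ ∪ P₃) ⊆ ((⋃ z ∈ W, (⇑T)^[z] '' B n) ∪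
      (⋃ y ∈ W', (⇑T)^[y] '' B (n + 1))) ∪
      ⋃ y ∈ Finset.range H', (⇑T)^[y] '' Bsub (n + 1) ((p (n + 1)).q - 1) := by
    rintro x ⟨hxA, hxP⟩
    by_contra hxR
    simp only [mem_union, mem_iUnion, exists_prop, not_or, not_exists, not_and] at hxR hxP
    obtain ⟨⟨hxW, hxW'⟩, hxlast⟩ := hxR
    obtain ⟨z, hz, hxz⟩ := mem_iUnion₂.1 (hAX hxA)
    have hzA : (⇑T)^[z] '' B n ⊆ A :=
      (hAn z (Finset.mem_range.1 hz)).resolve_right (not_disjoint_iff.2 ⟨x, hxz, hxA⟩)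
    have hzW : z ∉ W := fun hzW => hxW z hzW hxz
    rw [Finset.mem_range] at hz
    rw [h.union_sub n, image_iUnion₂] at hxz
    obtain ⟨i, hi, hxi⟩ := mem_iUnion₂.1 hxz
    rw [Finset.mem_range] at hi
    have hx' := hxi
    rw [← h.subcolumn n i hi z hz] at hx'
    have hyH : colStart p n i + z < H' := colStart_add_lt_heights p hi hz
    have hyA : (⇑T)^[colStart p n i + z] '' B (n + 1) ⊆ A := by
      rw [h.subcolumn n i hi z hz]
      exact (image_mono (h.sub_subset hi)).trans hzA
    have hyW : colStart p n i + z ∉ W' := fun hyW => hxW' _ hyW hx'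
    simp only [W, W', Finset.mem_filter, Finset.mem_range] at hzW hyW
    have hcoli := hcol i hi
    have hai := ha.lt i
    rcases lt_or_ge (colStart p n i + z + k) H' with hlt | hge
    · have hlt' : (i + j) * (H + (n + 1)) + a i + ρ + z < (p n).q * (H + (n + 1)) := by
        rw [← hHH']; omega
      by_cases hcase : z + ρ < H
      · have hij : i + j < (p n).q :=
          lt_of_mul_lt_mul_right (a := H + (n + 1)) (by omega) (Nat.zero_le _)
        refine hxP.1.1 (mem_iUnion₂.2 ⟨(z, i), ?_, hxi⟩)
        simp only [Z₁, Finset.mem_product, Finset.mem_filter, Finset.mem_range]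
        refine ⟨⟨hz, hzA, ?_, ?_⟩, ?_⟩ <;> omega
      · have hij : i + j + 1 < (p n).q := by
          refine lt_of_mul_lt_mul_right (a := H + (n + 1)) ?_ (Nat.zero_le _)
          rw [add_mul (i + j) 1]
          omega
        refine hxP.1.2 (mem_iUnion₂.2 ⟨(z, i), ?_, hxi⟩)
        simp only [Z₂, Finset.mem_product, Finset.mem_filter, Finset.mem_range]
        refine ⟨⟨hz, hzA, ?_, ?_⟩, ?_⟩ <;> omega
    · have hx'' := hx'
      rw [h.union_sub (n + 1), image_iUnion₂] at hx''
      obtain ⟨c, hc, hxc⟩ := mem_iUnion₂.1 hx''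
      rw [Finset.mem_range] at hc
      have hcne : c ≠ (p (n + 1)).q - 1 := by
        rintro rfl
        exact hxlast _ (Finset.mem_range.2 hyH) hxc
      refine hxP.2 (mem_iUnion₂.2 ⟨(colStart p n i + z, c), ?_, hxc⟩)
      simp only [Y, Finset.mem_product, Finset.mem_filter, Finset.mem_range]
      refine ⟨⟨hyH, hyA, ?_, ?_⟩, ?_⟩ <;> omega
  have hrest : μ.real (A \ (P₁ ∪ P₂ ∪ P₃)) ≤ (5 * (n + 1) : ℕ) / (H : ℝ) +
      (2 * (n + 2) : ℕ) / (H' : ℝ) + 1 / ((p (n + 1)).q : ℝ) := by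
    refine (measureReal_mono hcover).trans ((measureReal_union_le _ _).trans (add_le_add
      ((measureReal_union_le _ _).trans (add_le_add ?_ ?_)) ?_))
    · exact h.measureReal_biUnion_level_le hT n hWcard
    · exact h.measureReal_biUnion_level_le hT (n + 1) hWcard'
    · exact h.measureReal_biUnion_sub_le hT (by omega)
  have hCk : MeasurableSet ((⇑T)^[k] ⁻¹' C) := (hT.iterate k).measurable hC
  have hadd : ∀ {S R : Set X}, MeasurableSet R → Disjoint S R →
      μ.real ((S ∪ R) ∩ (⇑T)^[k] ⁻¹' C) - μ.real (S ∪ R) * μ.real C =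
      (μ.real (S ∩ (⇑T)^[k] ⁻¹' C) - μ.real S * μ.real C) +
      (μ.real (R ∩ (⇑T)^[k] ⁻¹' C) - μ.real R * μ.real C) := by
    intro S R hR hSR
    rw [union_inter_distrib_right, measureReal_union hSR hR, measureReal_union
      (hSR.mono inter_subset_left inter_subset_left) (hR.inter hCk)]
    ring
  have hsmall : |μ.real (A \ (P₁ ∪ P₂ ∪ P₃) ∩ (⇑T)^[k] ⁻¹' C)
      - μ.real (A \ (P₁ ∪ P₂ ∪ P₃)) * μ.real C| ≤ μ.real (A \ (P₁ ∪ P₂ ∪ P₃)) :=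
    abs_sub_le_of_nonneg_of_le measureReal_nonneg (measureReal_mono inter_subset_left)
      (mul_nonneg measureReal_nonneg measureReal_nonneg)
      (mul_le_of_le_one_right measureReal_nonneg measureReal_le_one)
  have hj1 : ∀ z ∈ Z₁, 1 ≤ j := by
    intro z hz
    have := hZ₁ z hz
    by_contra h0
    rw [show j = 0 by omega, zero_mul] at hkj
    omega
  have hb₁ : |μ.real (P₁ ∩ (⇑T)^[k] ⁻¹' C) - μ.real P₁ * μ.real C|
      ≤ 1 / ((n + 1 : ℕ) : ℝ) + cesaroDeviation μ T C (n + 1) := by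
    rcases Z₁.eq_empty_or_nonempty with he | ⟨z₀, hz₀⟩
    · have hP₁ : P₁ = ∅ := by simp [P₁, copies, he]
      rw [hP₁, empty_inter, measureReal_empty, zero_mul, sub_zero, abs_zero]
      exact add_nonneg (by positivity) (integral_nonneg fun x => abs_nonneg _)
    · refine h.abs_measureReal_copies_sub_le hT ha (hj1 z₀ hz₀) (fun z hz => ?_) hC hCn
      have := hZ₁ z hz
      rw [← hH]
      refine ⟨?_, ?_, ?_⟩ <;> omega
  have hb₂ : |μ.real (P₂ ∩ (⇑T)^[k] ⁻¹' C) - μ.real P₂ * μ.real C|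
      ≤ 1 / ((n + 1 : ℕ) : ℝ) + cesaroDeviation μ T C (n + 1) := by
    refine h.abs_measureReal_copies_sub_le hT ha (by omega) (fun z hz => ?_) hC hCn
    have := hZ₂ z hz
    rw [add_mul j 1, ← hH]
    refine ⟨?_, ?_, ?_⟩ <;> omega
  have hb₃ : |μ.real (P₃ ∩ (⇑T)^[k] ⁻¹' C) - μ.real P₃ * μ.real C|
      ≤ 1 / ((n + 1 + 1 : ℕ) : ℝ) + cesaroDeviation μ T C (n + 1 + 1) := by
    refine h.abs_measureReal_copies_sub_le hT ha' le_rfl (fun z hz => ?_) hC hCn'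
    have := hY z hz
    refine ⟨?_, ?_, ?_⟩ <;> omega
  have hsplit := hadd (hA.diff ((hP₁m.union hP₂m).union hP₃m)) (disjoint_sdiff_right
    (s := P₁ ∪ P₂ ∪ P₃) (t := A))
  rw [union_sdiff_cancel hPA, hadd hP₃m (hd₁₃.union_left hd₂₃), hadd hP₂m hd₁₂] at hsplit
  rw [hsplit, mixingBound]
  refine (abs_add_le _ _).trans (add_le_add ((abs_add_le _ _).trans (add_le_add
    ((abs_add_le _ _).trans ?_) hb₃)) (hsmall.trans hrest))
  rw [two_mul]
  exact add_le_add hb₁ hb₂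

end IsCuttingStacking

namespace IsCuttingStacking
variable {X : Type} [MeasurableSpace X] {μ : Measure X} [IsProbabilityMeasure μ] {T : X ≃ᵐ X}
  {p : ℕ → CSParam} {B : ℕ → Set X} {Bsub : ℕ → ℕ → Set X}

omit [IsProbabilityMeasure μ] in
lemma tendsto_mixingBound (hp : ∀ n, ∃ a, IsOrnsteinStep n (p n) a) {C : Set X}
    (hC : Tendsto (cesaroDeviation μ T C) atTop (𝓝 0)) :
    Tendsto (mixingBound μ T p C) atTop (𝓝 0) := by
  have hinv : Tendsto (fun n : ℕ => 1 / (n : ℝ)) atTop (𝓝 0) := tendsto_one_div_atTop_nhds_zero_nat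
  have hdev : Tendsto (fun n : ℕ => 1 / (n : ℝ) + cesaroDeviation μ T C n) atTop (𝓝 0) := by
    simpa using hinv.add hC
  have hr : Tendsto (fun n : ℕ => (n : ℝ) / 2 ^ n) atTop (𝓝 0) := by
    simpa [div_eq_mul_inv] using
      tendsto_pow_const_mul_const_pow_of_abs_lt_one 1 (r := (2 : ℝ)⁻¹) (by norm_num [abs_of_pos])
  have hheight : ∀ n, (2 : ℝ) ^ n ≤ heights p n := fun n => by exact_mod_cast two_pow_le_heights p n
  have h1 : Tendsto (fun n => ((5 * (n + 1) : ℕ) : ℝ) / heights p n) atTop (𝓝 0) := by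
    refine squeeze_zero (fun n => by positivity) (fun n => ?_)
      (by simpa using ((tendsto_add_atTop_iff_nat 1).2 hr).const_mul 10)
    calc ((5 * (n + 1) : ℕ) : ℝ) / heights p n ≤ ((5 * (n + 1) : ℕ) : ℝ) / 2 ^ n := by
          gcongr; exact hheight n
      _ = 10 * (((n : ℝ) + 1) / 2 ^ (n + 1)) := by
          push_cast; rw [pow_succ]; field_simp; ring
  have h2 : Tendsto (fun n => ((2 * (n + 2) : ℕ) : ℝ) / heights p (n + 1)) atTop (𝓝 0) := by
    refine squeeze_zero (fun n => by positivity) (fun n => ?_)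
      (by simpa using ((tendsto_add_atTop_iff_nat 2).2 hr).const_mul 4)
    calc ((2 * (n + 2) : ℕ) : ℝ) / heights p (n + 1) ≤ ((2 * (n + 2) : ℕ) : ℝ) / 2 ^ (n + 1) := by
          gcongr; exact hheight _
      _ = 4 * (((n : ℝ) + 2) / 2 ^ (n + 2)) := by
          push_cast; rw [pow_succ, pow_succ]; field_simp; ring
  have h3 : Tendsto (fun n => 1 / ((p (n + 1)).q : ℝ)) atTop (𝓝 0) := by
    refine squeeze_zero (fun n => by positivity) (fun n => ?_)
      ((tendsto_add_atTop_iff_nat 1).2 hinv)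
    obtain ⟨a, ha⟩ := hp (n + 1)
    have := ha.le_q
    exact one_div_le_one_div_of_le (by positivity) (by exact_mod_cast (by omega))
  have := ((((tendsto_add_atTop_iff_nat 1).2 hdev).const_mul 2).add
    ((tendsto_add_atTop_iff_nat 2).2 hdev)).add ((h1.add h2).add h3)
  simp only [mul_zero, add_zero] at this
  exact this

lemma exists_heights_le_lt (p : ℕ → CSParam) {N k : ℕ} (hk : heights p N ≤ k) :
    ∃ n, N ≤ n ∧ heights p n ≤ k ∧ k < heights p (n + 1) := by
  induction k, hk using Nat.le_induction with
  | base => exact ⟨N, le_rfl, le_rfl, heights_strictMono p (Nat.lt_succ_self N)⟩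
  | succ k _ ih =>
    obtain ⟨n, hNn, hn, hkn⟩ := ih
    rcases Nat.lt_or_ge (k + 1) (heights p (n + 1)) with hlt | hge
    · exact ⟨n, hNn, by omega, hlt⟩
    · exact ⟨n + 1, by omega, hge, by
        have := heights_strictMono p (Nat.lt_add_one (n + 1)); omega⟩

omit [IsProbabilityMeasure μ] in
lemma adapted_level (h : IsCuttingStacking T p B Bsub) {m n l : ℕ} (hmn : m ≤ n)
    (hl : l < heights p m) : Adapted T p B n ((⇑T)^[l] '' B m) :=
  fun _ hz => h.level_subset_or_disjoint hmn hl hz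

lemma tendsto_measureReal_level_inter (h : IsCuttingStacking T p B Bsub)
    (hT : MeasurePreserving T μ μ) (hp : ∀ n, ∃ a, IsOrnsteinStep n (p n) a) {m l m' l' : ℕ}
    (hl : l < heights p m) (hl' : l' < heights p m')
    (hdev : Tendsto (cesaroDeviation μ T ((⇑T)^[l'] '' B m')) atTop (𝓝 0)) :
    Tendsto (fun k => μ.real ((⇑T)^[l] '' B m ∩ (⇑T)^[k] ⁻¹' ((⇑T)^[l'] '' B m'))) atTop
      (𝓝 (μ.real ((⇑T)^[l] '' B m) * μ.real ((⇑T)^[l'] '' B m'))) := by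
  rw [Metric.tendsto_atTop]
  intro ε hε
  obtain ⟨N, hN⟩ := eventually_atTop.1
    ((tendsto_mixingBound hp hdev).eventually (gt_mem_nhds hε))
  refine ⟨heights p (N + m + m'), fun k hk => ?_⟩
  obtain ⟨n, hNn, hnk, hkn⟩ := exists_heights_le_lt p hk
  obtain ⟨a, ha⟩ := hp n
  obtain ⟨a', ha'⟩ := hp (n + 1)
  rw [Real.dist_eq]
  exact (h.abs_measureReal_inter_sub_le hT ha ha' hnk hkn (h.measurableSet_level m l)
    (h.adapted_level (by omega) hl)
    ((level_subset_towerUnion hl).trans (h.towerUnion_mono (by omega)))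
    (h.measurableSet_level m' l') (h.adapted_level (by omega) hl')
    (h.adapted_level (by omega) hl')).trans_lt (hN n (by omega))

lemma tendsto_measureReal_inter_level (h : IsCuttingStacking T p B Bsub)
    (hgen : TowersGenerate μ T p B) (hT : MeasurePreserving T μ μ)
    (hp : ∀ n, ∃ a, IsOrnsteinStep n (p n) a) {m l : ℕ} (hl : l < heights p m)
    (hdev : Tendsto (cesaroDeviation μ T ((⇑T)^[l] '' B m)) atTop (𝓝 0)) {A : Set X}
    (hA : MeasurableSet A) :
    Tendsto (fun k => μ.real (A ∩ (⇑T)^[k] ⁻¹' ((⇑T)^[l] '' B m))) atTop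
      (𝓝 (μ.real A * μ.real ((⇑T)^[l] '' B m))) := by
  set C := (⇑T)^[l] '' B m with hCdef
  have hC : MeasurableSet C := h.measurableSet_level m l
  have hCk : ∀ k, MeasurableSet ((⇑T)^[k] ⁻¹' C) := fun k => (hT.iterate k).measurable hC
  refine h.induction_on_levels hgen (P := fun A => Tendsto (fun k => μ.real (A ∩ (⇑T)^[k] ⁻¹' C))
    atTop (𝓝 (μ.real A * μ.real C))) ?_ ?_ ?_ ?_ ?_ hA
  · simp
  · exact fun n i hi => h.tendsto_measureReal_level_inter hT hp hi hl hdev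
  · intro A hA ih
    have h1 : ∀ k, μ.real (Aᶜ ∩ (⇑T)^[k] ⁻¹' C) = μ.real C - μ.real (A ∩ (⇑T)^[k] ⁻¹' C) := by
      intro k
      have := measureReal_inter_add_sdiff (μ := μ) (s := (⇑T)^[k] ⁻¹' C) hA
      rw [(hT.iterate k).measureReal_preimage hC.nullMeasurableSet, sdiff_eq, inter_comm _ A,
        inter_comm _ Aᶜ] at this
      linarith
    simp only [h1]
    rw [measureReal_compl hA, probReal_univ, sub_mul, one_mul]
    exact tendsto_const_nhds.sub ih
  · intro f hd hf ih
    have hsum := hasSum_measureReal_iUnion (μ := μ) hf hd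
    have h1 : ∀ k, μ.real ((⋃ i, f i) ∩ (⇑T)^[k] ⁻¹' C) =
        ∑' i, μ.real (f i ∩ (⇑T)^[k] ⁻¹' C) := by
      intro k
      rw [iUnion_inter]
      exact (hasSum_measureReal_iUnion (fun i => (hf i).inter (hCk k)) fun i j hij =>
        (hd hij).mono inter_subset_left inter_subset_left).tsum_eq.symm
    simp only [h1]
    rw [← (hsum.mul_right (μ.real C)).tsum_eq]
    refine tendsto_tsum_of_dominated_convergence hsum.summable ih
      (Eventually.of_forall fun k i => ?_)
    rw [Real.norm_of_nonneg measureReal_nonneg]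
    exact measureReal_mono inter_subset_left
  · intro A A' hAA' ih
    have h1 : ∀ k, μ.real (A ∩ (⇑T)^[k] ⁻¹' C) = μ.real (A' ∩ (⇑T)^[k] ⁻¹' C) := fun k =>
      measureReal_congr (hAA'.inter (ae_eq_refl _))
    simp only [h1]
    rwa [measureReal_congr hAA']

lemma tendsto_measureReal_inter [StandardBorelSpace X] [NullSingletonClass μ]
    (h : IsCuttingStacking T p B Bsub) (hgen : TowersGenerate μ T p B)
    (hT : MeasurePreserving T μ μ) (hp : ∀ n, ∃ a, IsOrnsteinStep n (p n) a) {A C : Set X}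
    (hA : MeasurableSet A) (hC : MeasurableSet C) :
    Tendsto (fun k => μ.real (A ∩ (⇑T)^[k] ⁻¹' C)) atTop (𝓝 (μ.real A * μ.real C)) := by
  have hmeas : ∀ k {S : Set X}, MeasurableSet S → MeasurableSet ((⇑T)^[k] ⁻¹' S) :=
    fun k _ hS => (hT.iterate k).measurable hS
  refine h.induction_on_levels hgen (P := fun C => Tendsto (fun k => μ.real (A ∩ (⇑T)^[k] ⁻¹' C))
    atTop (𝓝 (μ.real A * μ.real C))) ?_ ?_ ?_ ?_ ?_ hC
  · simp
  · exact fun n i hi => h.tendsto_measureReal_inter_level hgen hT hp hi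
      ((h.ergodic hgen hT).tendsto_cesaroDeviation (h.measurableSet_level n i)) hA
  · intro C hC ih
    have h1 : ∀ k, μ.real (A ∩ (⇑T)^[k] ⁻¹' Cᶜ) = μ.real A - μ.real (A ∩ (⇑T)^[k] ⁻¹' C) := by
      intro k
      have := measureReal_inter_add_sdiff (μ := μ) (s := A) (hmeas k hC)
      rw [sdiff_eq] at this
      rw [preimage_compl]
      linarith
    simp only [h1]
    rw [measureReal_compl hC, probReal_univ, mul_sub, mul_one]
    exact tendsto_const_nhds.sub ih
  · intro f hd hf ih
    have hsum := hasSum_measureReal_iUnion (μ := μ) hf hd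
    have h1 : ∀ k, μ.real (A ∩ (⇑T)^[k] ⁻¹' ⋃ i, f i) = ∑' i, μ.real (A ∩ (⇑T)^[k] ⁻¹' f i) := by
      intro k
      rw [preimage_iUnion, inter_iUnion]
      exact (hasSum_measureReal_iUnion (fun i => hA.inter (hmeas k (hf i))) fun i j hij =>
        ((hd hij).preimage _).mono inter_subset_right inter_subset_right).tsum_eq.symm
    simp only [h1]
    rw [← (hsum.mul_left (μ.real A)).tsum_eq]
    refine tendsto_tsum_of_dominated_convergence hsum.summable ih
      (Eventually.of_forall fun k i => ?_)
    rw [Real.norm_of_nonneg measureReal_nonneg,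
      ← (hT.iterate k).measureReal_preimage (hf i).nullMeasurableSet]
    exact measureReal_mono inter_subset_right
  · intro C C' hCC' ih
    have h1 : ∀ k, μ.real (A ∩ (⇑T)^[k] ⁻¹' C) = μ.real (A ∩ (⇑T)^[k] ⁻¹' C') := fun k =>
      measureReal_congr ((ae_eq_refl A).inter
        ((hT.iterate k).quasiMeasurePreserving.preimage_ae_eq hCC'))
    simp only [h1]
    rwa [measureReal_congr hCC']

end IsCuttingStacking

/-- The class of strongly mixing rank-one systems is a flexible
class. -/
theorem strongly_mixing_rank_one_flexible :
    IsFlexibleClass (fun 𝒮 : MSystem =>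
      IsRankOne 𝒮.μ 𝒮.T ∧ StronglyMixing 𝒮.μ (⇑𝒮.T)) := by
  refine flexible_of_isOrnsteinStep ?_
  rintro p hp 𝒮 ⟨hborel, hprob, hatoms⟩ hrank
  refine ⟨⟨p, hrank⟩, fun A C hA hC => ?_⟩
  obtain ⟨hT, -, B, Bsub, hcs, hgen⟩ := hrank
  have : NullSingletonClass 𝒮.μ := hatoms
  have hlim := (hcs.tendsto_measureReal_inter hgen hT hp hA hC).sub_const
    (𝒮.μ.real A * 𝒮.μ.real C)
  have habs := hlim.abs
  rw [sub_self, abs_zero] at habs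
  exact habs
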